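/- arXiv:1908.01632 — 7 statements merged into one kernel-verified Lean document; each statement's English description precedes it below -/
import Mathlib

section
/- Let 1 < α < 2, β = 1/(α−1), and let u₋ > u₊ be real numbers. Let S₁ : ℝ → ℝ take values in [u₊, u₋], and assume there exist constants C₀ > 0 and c₊, c₋ > 0 such that 0 ≤ S₁(ξ) − u₊ ≤ C₀ e^{−c₊ ξ} for all ξ ≥ 0 and 0 ≤ u₋ − S₁(ξ) ≤ C₀ e^{c₋ ξ} for all ξ ≤ 0. Define ψ(ε) = inf_{δ ≥ 4} √( δε^β + √(δε^β) + (S₁(√δ) − u₊) + (u₋ − S₁(−√δ)) + δ^{−(α−1)} ) + ε^{β/2} for ε > 0. Then there exist constants ε₀ > 0 and C > 0 such that ψ(ε) ≤ C ε^{1/(2(2α−1))} for all 0 < ε < ε₀. -/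
open MeasureTheory Real Filter
open scoped ENNReal NNReal

/-- The rate function
`ψ(ε) = inf_{δ ≥ 4} √( δε^β + √(δε^β) + (S₁(√δ) − u₊) + (u₋ − S₁(−√δ)) + δ^{−(α−1)} ) + ε^{β/2}`. -/
noncomputable def psi (α β upl umn : ℝ) (S₁ : ℝ → ℝ) (ε : ℝ) : ℝ :=
  sInf ((fun δ : ℝ => Real.sqrt (δ * ε ^ β + Real.sqrt (δ * ε ^ β)
      + (S₁ (Real.sqrt δ) - upl) + (umn - S₁ (-Real.sqrt δ)) + δ ^ (-(α - 1)))) ''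
      (Set.Ici (4 : ℝ)))
  + ε ^ (β / 2)

/-- Exponential decay in `√δ` is dominated by any power `δ ^ (-r)` with `r ≤ 1`, for `δ ≥ 1`. -/
theorem exp_neg_mul_sqrt_le_rpow {c δ r : ℝ} (hc : 0 < c) (hδ : 1 ≤ δ) (hr : r ≤ 1) :
    Real.exp (-c * √δ) ≤ 2 / c ^ 2 * δ ^ (-r) := by
  have hδ0 : 0 < δ := by linarith
  have hquad := Real.quadratic_le_exp_of_nonneg (mul_nonneg hc.le (Real.sqrt_nonneg δ))
  have hsq : (c * √δ) ^ 2 = c ^ 2 * δ := by rw [mul_pow, Real.sq_sqrt hδ0.le]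
  have hlow : c ^ 2 * δ / 2 ≤ Real.exp (c * √δ) := by
    have : 0 ≤ c * √δ := by positivity
    linarith
  have hpow : δ⁻¹ ≤ δ ^ (-r) := by
    rw [← Real.rpow_neg_one]
    exact Real.rpow_le_rpow_of_exponent_le hδ (by linarith)
  calc Real.exp (-c * √δ) = (Real.exp (c * √δ))⁻¹ := by rw [neg_mul, Real.exp_neg]
    _ ≤ (c ^ 2 * δ / 2)⁻¹ := inv_anti₀ (by positivity) hlow
    _ = 2 / c ^ 2 * δ⁻¹ := by field_simp
    _ ≤ 2 / c ^ 2 * δ ^ (-r) := by gcongr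

/-- The infimum defining `psi` is bounded by the value at any admissible `δ`. -/
theorem psi_le_of_four_le (α β upl umn : ℝ) (S₁ : ℝ → ℝ) (ε : ℝ) {δ : ℝ} (hδ : 4 ≤ δ) :
    psi α β upl umn S₁ ε ≤ √(δ * ε ^ β + √(δ * ε ^ β) + (S₁ (√δ) - upl)
      + (umn - S₁ (-√δ)) + δ ^ (-(α - 1))) + ε ^ (β / 2) := by
  unfold psi
  gcongr
  refine csInf_le ⟨0, ?_⟩ ⟨δ, hδ, rfl⟩
  rintro _ ⟨x, -, rfl⟩
  exact Real.sqrt_nonneg _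

/-- If the layer profile `S₁` approaches its end states exponentially fast, then
`ψ(ε) ≤ C ε^{1/(2(2α−1))}` for all sufficiently small `ε > 0`. -/
theorem psi_rate_exponential_layer
    (α β umn upl : ℝ) (hα1 : 1 < α) (hα2 : α < 2) (hβ : β = 1 / (α - 1))
    (hu : upl < umn)
    (S₁ : ℝ → ℝ) (hS₁range : ∀ ξ, S₁ ξ ∈ Set.Icc upl umn)
    (C₀ cpl cmn : ℝ) (hC₀ : 0 < C₀) (hcpl : 0 < cpl) (hcmn : 0 < cmn)
    (hdecayTop : ∀ ξ : ℝ, 0 ≤ ξ → 0 ≤ S₁ ξ - upl ∧ S₁ ξ - upl ≤ C₀ * Real.exp (-cpl * ξ))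
    (hdecayBot : ∀ ξ : ℝ, ξ ≤ 0 → 0 ≤ umn - S₁ ξ ∧ umn - S₁ ξ ≤ C₀ * Real.exp (cmn * ξ)) :
    ∃ ε₀ : ℝ, 0 < ε₀ ∧ ∃ C : ℝ, 0 < C ∧ ∀ ε : ℝ, 0 < ε → ε < ε₀ →
      psi α β upl umn S₁ ε ≤ C * ε ^ (1 / (2 * (2 * α - 1))) := by
  have hα : 0 < α - 1 := by linarith
  have hm0 : 0 < 2 * α - 1 := by linarith
  set m : ℝ := 1 / (2 * α - 1) with hm
  have hmpos : 0 < m := by positivity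
  set p : ℝ := 1 / ((α - 1) * (2 * α - 1)) with hp
  have hppos : 0 < p := by positivity
  have hpα : -p * -(α - 1) = m := by
    rw [hp, hm]
    field_simp
  have hpβ : -p + β = 2 * m := by
    have hm1 : m * (2 * α - 1) = 1 := one_div_mul_cancel hm0.ne'
    have hβ1 : β * (α - 1) = 1 := by rw [hβ, one_div_mul_cancel hα.ne']
    refine mul_right_cancel₀ hα.ne' ?_
    linear_combination hβ1 - hpα - hm1
  have hmβ : m / 2 ≤ β / 2 := by linarith
  have hmhalf : 1 / (2 * (2 * α - 1)) = m / 2 := by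
    rw [hm]
    field_simp
  set K : ℝ := 3 + C₀ * (2 / cpl ^ 2) + C₀ * (2 / cmn ^ 2) with hK
  have hK0 : 0 < K := by positivity
  refine ⟨4 ^ (-p⁻¹), by positivity, √K + 1, by positivity, fun ε hε hε₀ => ?_⟩
  have hε1 : ε ≤ 1 := hε₀.le.trans
    (Real.rpow_le_one_of_one_le_of_nonpos (by norm_num) (by simpa using hppos.le))
  set δ : ℝ := ε ^ (-p) with hδ
  have hδ4 : 4 ≤ δ := by
    calc (4 : ℝ) = (4 ^ (-p⁻¹)) ^ (-p) := by
          rw [← Real.rpow_mul (by norm_num), neg_mul_neg, inv_mul_cancel₀ hppos.ne',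
            Real.rpow_one]
      _ ≤ ε ^ (-p) := Real.rpow_le_rpow_of_nonpos hε hε₀.le (by linarith)
  have hδα : δ ^ (-(α - 1)) = ε ^ m := by
    rw [hδ, ← Real.rpow_mul hε.le, hpα]
  have hδβ : δ * ε ^ β = ε ^ (2 * m) := by
    rw [hδ, ← Real.rpow_add hε, hpβ]
  have hsqrt : √(ε ^ (2 * m)) = ε ^ m := by
    rw [Real.sqrt_eq_rpow, ← Real.rpow_mul hε.le]
    congr 1
    ring
  have hsq : ε ^ (2 * m) ≤ ε ^ m :=
    Real.rpow_le_rpow_of_exponent_ge hε hε1 (by linarith)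
  have htop : S₁ (√δ) - upl ≤ C₀ * (2 / cpl ^ 2) * ε ^ m := by
    refine (hdecayTop _ (Real.sqrt_nonneg δ)).2.trans ?_
    rw [← hδα, mul_assoc]
    gcongr
    exact exp_neg_mul_sqrt_le_rpow hcpl (by linarith) (by linarith)
  have hbot : umn - S₁ (-√δ) ≤ C₀ * (2 / cmn ^ 2) * ε ^ m := by
    refine (hdecayBot _ (neg_nonpos.2 (Real.sqrt_nonneg δ))).2.trans ?_
    rw [← hδα, mul_assoc, mul_neg, ← neg_mul]
    gcongr
    exact exp_neg_mul_sqrt_le_rpow hcmn (by linarith) (by linarith)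
  have hsqrt_half : √(ε ^ m) = ε ^ (m / 2) := by
    rw [Real.sqrt_eq_rpow, ← Real.rpow_mul hε.le]
    congr 1
    ring
  calc psi α β upl umn S₁ ε
      ≤ √(δ * ε ^ β + √(δ * ε ^ β) + (S₁ (√δ) - upl) + (umn - S₁ (-√δ)) + δ ^ (-(α - 1)))
          + ε ^ (β / 2) := psi_le_of_four_le α β upl umn S₁ ε hδ4
    _ ≤ √(K * ε ^ m) + ε ^ (m / 2) := by
        refine add_le_add (Real.sqrt_le_sqrt ?_) (Real.rpow_le_rpow_of_exponent_ge hε hε1 hmβ)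
        rw [hδβ, hsqrt, hδα, hK]
        linarith
    _ = (√K + 1) * ε ^ (1 / (2 * (2 * α - 1))) := by
        rw [Real.sqrt_mul hK0.le, hsqrt_half, hmhalf]
        ring
end

section
/- Let 1 < α < 2 and let A : ℝ → ℝ be a smooth, strictly convex flux (A''(u) > 0 for all u). Let u₋ > u₊ and suppose S₁ : ℝ → ℝ is a bounded C³ function with bounded first, second, and third derivatives, with S₁' ∈ L¹(ℝ) and S₁'(ξ) → 0 as |ξ| → ∞, which solves the profile equation (A(S₁(x)))' = Δ^{α/2}S₁(x) pointwise on ℝ and satisfies S₁(ξ) → u₋ as ξ → −∞, S₁(ξ) → u₊ as ξ → +∞. Assume moreover that ∬_{ℝ²} ((S₁')₊(x) − (S₁')₊(y))² |x−y|^{−1−α} dx dy < ∞, that (S₁')₊ · Δ^{α/2}(S₁') ∈ L¹(ℝ), and that (x,z) ↦ (S₁')₊(x)(S₁'(x+z) + S₁'(x−z) − 2S₁'(x))|z|^{−1−α} is absolutely integrable on ℝ². Then S₁'(x) ≤ 0 for all x ∈ ℝ, i.e. the shock layer is nonincreasing. -/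
open MeasureTheory Real Filter
open scoped ENNReal NNReal

/-- The fractional Laplacian `Δ^{α/2}` of a function `u : ℝ → ℝ`, with normalizing
constant `cα`, written in the symmetric (second-difference) form. -/
noncomputable def fracLap (cα α : ℝ) (u : ℝ → ℝ) (x : ℝ) : ℝ :=
  (cα / 2) * ∫ z : ℝ, (u (x + z) + u (x - z) - 2 * u x) / |z| ^ (1 + α)

/-- The truncated quadratic kernel dominating second-difference quotients is integrable. -/
lemma integrable_min_one_sq_div_abs_rpow {α : ℝ} (hα1 : 0 < α) (hα2 : α < 2) :
    Integrable (fun z : ℝ => min 1 (z ^ 2) / |z| ^ (1 + α)) := by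
  have hIoi : IntegrableOn (fun z : ℝ => min 1 (z ^ 2) / |z| ^ (1 + α)) (Set.Ioi 0) := by
    rw [← Set.Ioc_union_Ioi_eq_Ioi (zero_le_one' ℝ)]
    refine IntegrableOn.union ?_ ?_
    · have h := (intervalIntegral.intervalIntegrable_rpow' (a := 0) (b := 1)
        (show -1 < 1 - α by linarith))
      rw [intervalIntegrable_iff_integrableOn_Ioc_of_le zero_le_one] at h
      refine h.congr_fun (fun z hz => ?_) measurableSet_Ioc
      have hz0 : 0 < z := hz.1
      have hz1 : z ^ 2 ≤ 1 := by nlinarith [hz.2]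
      simp only [min_eq_right hz1, abs_of_pos hz0]
      rw [← Real.rpow_natCast z 2, ← Real.rpow_sub hz0]
      congr 1
      push_cast
      ring
    · refine (integrableOn_Ioi_rpow_of_lt (show -(1 + α) < -1 by linarith) one_pos).congr_fun
        (fun z hz => ?_) measurableSet_Ioi
      have hz1 : 1 < z := hz
      have hz0 : 0 < z := by linarith
      have hz2 : 1 ≤ z ^ 2 := by nlinarith
      simp only [min_eq_left hz2, abs_of_pos hz0]
      rw [Real.rpow_neg hz0.le, one_div]
  have hIic : IntegrableOn (fun z : ℝ => min 1 (z ^ 2) / |z| ^ (1 + α)) (Set.Iic 0) := by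
    rw [← Measure.map_neg_eq_self (volume : Measure ℝ)]
    have m : MeasurableEmbedding fun x : ℝ => -x := (Homeomorph.neg ℝ).measurableEmbedding
    rw [m.integrableOn_map_iff]
    simp_rw [Function.comp_def, abs_neg, neg_sq, Set.neg_preimage, Set.neg_Iic, neg_zero]
    exact Iff.mpr integrableOn_Ici_iff_integrableOn_Ioi hIoi
  rw [← integrableOn_univ, ← Set.Iic_union_Ioi (a := (0 : ℝ))]
  exact hIic.union hIoi

/-- Second differences of a bounded function with bounded second derivative. -/
lemma abs_second_difference_le {u u' u'' : ℝ → ℝ} {M : ℝ} (hu : ∀ x, HasDerivAt u (u' x) x)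
    (hu' : ∀ x, HasDerivAt u' (u'' x) x) (hM : ∀ x, |u x| ≤ M) (hM'' : ∀ x, |u'' x| ≤ M)
    (x z : ℝ) : |u (x + z) + u (x - z) - 2 * u x| ≤ 4 * M * min 1 (z ^ 2) := by
  have hM0 : 0 ≤ M := (abs_nonneg _).trans (hM 0)
  have hlip : ∀ a b : ℝ, |u' b - u' a| ≤ M * |b - a| := fun a b =>
    convex_univ.norm_image_sub_le_of_norm_hasDerivWithin_le (f := u') (f' := u'')
      (fun y _ => (hu' y).hasDerivWithinAt) (fun y _ => hM'' y) (Set.mem_univ a) (Set.mem_univ b)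
  have hquad : |u (x + z) + u (x - z) - 2 * u x| ≤ 2 * M * z ^ 2 := by
    have hd : ∀ y ∈ Set.Icc (-|z|) |z|,
        HasDerivWithinAt (fun t => u (x + t) + u (x - t)) (u' (x + y) - u' (x - y))
          (Set.Icc (-|z|) |z|) y := fun y _ => by
      have h1 : HasDerivAt (fun t => u (x + t)) (u' (x + y)) y := (hu (x + y)).comp_const_add x y
      have h2 : HasDerivAt (fun t => u (x - t)) (-u' (x - y)) y := (hu (x - y)).comp_const_sub x y
      exact ((h1.add h2).congr_deriv (sub_eq_add_neg _ _).symm).hasDerivWithinAt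
    have hb : ∀ y ∈ Set.Icc (-|z|) |z|, ‖u' (x + y) - u' (x - y)‖ ≤ 2 * M * |z| := fun y hy => by
      have h := hlip (x - y) (x + y)
      have hy' : |y| ≤ |z| := abs_le.mpr hy
      rw [show x + y - (x - y) = 2 * y by ring, abs_mul, abs_two] at h
      rw [Real.norm_eq_abs]
      nlinarith
    have h := (convex_Icc (-|z|) |z|).norm_image_sub_le_of_norm_hasDerivWithin_le hd hb
      (x := 0) (y := z) ⟨by simp, by simp⟩ ⟨neg_abs_le z, le_abs_self z⟩
    simp only [add_zero, sub_zero, Real.norm_eq_abs] at h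
    rw [mul_assoc, abs_mul_abs_self] at h
    rw [show u (x + z) + u (x - z) - 2 * u x = u (x + z) + u (x - z) - (u x + u x) by ring]
    linarith
  have hconst : |u (x + z) + u (x - z) - 2 * u x| ≤ 4 * M := by
    have h1 := abs_le.mp (hM (x + z))
    have h2 := abs_le.mp (hM (x - z))
    have h3 := abs_le.mp (hM x)
    exact abs_le.mpr ⟨by linarith, by linarith⟩
  rcases min_cases 1 (z ^ 2) with ⟨h, -⟩ | ⟨h, -⟩ <;> rw [h]
  · linarith
  · nlinarith [sq_nonneg z]

/-- The fractional Laplacian commutes with differentiation. -/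
lemma hasDerivAt_fracLap {cα α M : ℝ} (hα1 : 0 < α) (hα2 : α < 2) {u u' u'' u''' : ℝ → ℝ}
    (hu : ∀ x, HasDerivAt u (u' x) x) (hu' : ∀ x, HasDerivAt u' (u'' x) x)
    (hu'' : ∀ x, HasDerivAt u'' (u''' x) x) (hM : ∀ x, |u x| ≤ M) (hM' : ∀ x, |u' x| ≤ M)
    (hM'' : ∀ x, |u'' x| ≤ M) (hM''' : ∀ x, |u''' x| ≤ M) (x : ℝ) :
    HasDerivAt (fracLap cα α u) (fracLap cα α u' x) x := by
  have hmeas : ∀ {f : ℝ → ℝ}, Continuous f → ∀ y : ℝ, AEStronglyMeasurable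
      (fun z : ℝ => (f (y + z) + f (y - z) - 2 * f y) / |z| ^ (1 + α)) volume := fun hf y => by
    have := hf.measurable
    exact Measurable.aestronglyMeasurable (by fun_prop)
  have hbound : ∀ {f : ℝ → ℝ} (y z : ℝ), |f (y + z) + f (y - z) - 2 * f y| ≤
      4 * M * min 1 (z ^ 2) → ‖(f (y + z) + f (y - z) - 2 * f y) / |z| ^ (1 + α)‖ ≤
      4 * M * (min 1 (z ^ 2) / |z| ^ (1 + α)) := fun y z h => by
    have h0 : 0 ≤ |z| ^ (1 + α) := Real.rpow_nonneg (abs_nonneg z) _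
    rw [norm_div, Real.norm_eq_abs, Real.norm_eq_abs, abs_of_nonneg h0, ← mul_div_assoc]
    exact div_le_div_of_nonneg_right h h0
  have h_int := (integrable_min_one_sq_div_abs_rpow hα1 hα2).const_mul (4 * M)
  have hcu : Continuous u := continuous_iff_continuousAt.mpr fun y => (hu y).continuousAt
  have hcu' : Continuous u' := continuous_iff_continuousAt.mpr fun y => (hu' y).continuousAt
  refine HasDerivAt.const_mul (cα / 2) (hasDerivAt_integral_of_dominated_loc_of_deriv_le
    (F := fun y z => (u (y + z) + u (y - z) - 2 * u y) / |z| ^ (1 + α))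
    (F' := fun y z => (u' (y + z) + u' (y - z) - 2 * u' y) / |z| ^ (1 + α))
    (s := Set.univ) univ_mem (Eventually.of_forall fun y => hmeas hcu y)
    (h_int.mono' (hmeas hcu x) (ae_of_all _ fun z => hbound x z
      (abs_second_difference_le hu hu' hM hM'' x z)))
    (hmeas hcu' x) (ae_of_all _ fun z y _ => hbound y z
      (abs_second_difference_le hu' hu'' hM' hM''' y z)) h_int
    (ae_of_all _ fun z y _ => ?_)).2
  have h1 : HasDerivAt (fun t => u (t + z)) (u' (y + z)) y := (hu (y + z)).comp_add_const y z
  have h2 : HasDerivAt (fun t => u (t - z)) (u' (y - z)) y := (hu (y - z)).comp_sub_const y z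
  exact ((h1.add h2).sub ((hu y).const_mul 2)).div_const _

/-- Pairing the positive part of an integrable bounded function with one of its second differences
gives a nonpositive number. -/
lemma integral_posPart_mul_second_difference_nonpos {v : ℝ → ℝ}
    (hv2 : Integrable fun x => max (v x) 0 ^ 2) (z : ℝ) :
    ∫ x, max (v x) 0 * (v (x + z) + v (x - z) - 2 * v x) ≤ 0 := by
  by_cases h_int : Integrable fun x => max (v x) 0 * (v (x + z) + v (x - z) - 2 * v x)
  swap
  · rw [integral_undef h_int]
  have hp : Integrable fun x => max (v (x + z)) 0 ^ 2 := hv2.comp_add_right z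
  have hm : Integrable fun x => max (v (x - z)) 0 ^ 2 := hv2.comp_sub_right z
  calc ∫ x, max (v x) 0 * (v (x + z) + v (x - z) - 2 * v x)
      ≤ ∫ x, ((max (v (x + z)) 0 ^ 2 + max (v (x - z)) 0 ^ 2) / 2 - max (v x) 0 ^ 2) := by
        refine integral_mono h_int (((hp.add hm).div_const 2).sub hv2) fun x => ?_
        have h0 : 0 ≤ max (v x) 0 := le_max_right _ _
        have h1 := mul_le_mul_of_nonneg_left (le_max_left (v (x + z)) 0) h0
        have h2 := mul_le_mul_of_nonneg_left (le_max_left (v (x - z)) 0) h0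
        have h3 : max (v x) 0 * v x = max (v x) 0 ^ 2 := by
          rcases max_cases (v x) 0 with ⟨h, -⟩ | ⟨h, -⟩ <;> rw [h] <;> ring
        nlinarith [sq_nonneg (max (v x) 0 - max (v (x + z)) 0),
          sq_nonneg (max (v x) 0 - max (v (x - z)) 0)]
    _ = 0 := by
        have hpm : Integrable fun x => (max (v (x + z)) 0 ^ 2 + max (v (x - z)) 0 ^ 2) / 2 :=
          (hp.add hm).div_const 2
        rw [integral_sub hpm hv2, integral_div, integral_add hp hm,
          integral_add_right_eq_self (fun x => max (v x) 0 ^ 2) z,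
          integral_sub_right_eq_self (fun x => max (v x) 0 ^ 2) z]
        ring

/-- The fractional Laplacian is dissipative against the positive part. -/
lemma integral_posPart_mul_fracLap_nonpos {cα α : ℝ} (hcα : 0 ≤ cα) {v : ℝ → ℝ}
    (hv2 : Integrable fun x => max (v x) 0 ^ 2)
    (hker : Integrable
      (fun p : ℝ × ℝ => max (v p.1) 0 *
        (v (p.1 + p.2) + v (p.1 - p.2) - 2 * v p.1) / |p.2| ^ (1 + α)) volume) :
    ∫ x, max (v x) 0 * fracLap cα α v x ≤ 0 := by
  have hrw : ∀ x, max (v x) 0 * fracLap cα α v x = (cα / 2) *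
      ∫ z, max (v x) 0 * (v (x + z) + v (x - z) - 2 * v x) / |z| ^ (1 + α) := fun x => by
    simp_rw [fracLap, mul_div_assoc (max (v x) 0), integral_const_mul]
    ring
  simp_rw [hrw, integral_const_mul]
  refine mul_nonpos_of_nonneg_of_nonpos (by positivity) ?_
  rw [integral_integral_swap hker]
  refine integral_nonpos fun z => ?_
  simp_rw [integral_div]
  exact div_nonpos_of_nonpos_of_nonneg (integral_posPart_mul_second_difference_nonpos hv2 z)
    (Real.rpow_nonneg (abs_nonneg z) _)

lemma hasDerivAt_max_zero_sq (y : ℝ) : HasDerivAt (fun t : ℝ => max t 0 ^ 2) (2 * max y 0) y := by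
  rcases lt_trichotomy y 0 with hy | rfl | hy
  · rw [max_eq_right hy.le, mul_zero]
    refine (hasDerivAt_const y (0 : ℝ)).congr_of_eventuallyEq ?_
    filter_upwards [gt_mem_nhds hy] with t ht
    simp [max_eq_right ht.le]
  · rw [max_self, mul_zero, hasDerivAt_iff_isLittleO]
    have h : (fun t : ℝ => t ^ 2) =o[nhds 0] fun t => t := by
      simpa using Asymptotics.isLittleO_pow_pow (𝕜 := ℝ) one_lt_two
    refine (Asymptotics.IsBigO.of_bound 1 (Eventually.of_forall fun t => ?_)).trans_isLittleO
      (h.congr_right fun t => (sub_zero t).symm)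
    rcases max_cases t 0 with ⟨ht, -⟩ | ⟨ht, -⟩ <;> simp [ht, sq_nonneg]
  · rw [max_eq_left hy.le]
    have h : HasDerivAt (fun t : ℝ => t ^ 2) (2 * y) y := by simpa using hasDerivAt_pow 2 y
    refine h.congr_of_eventuallyEq ?_
    filter_upwards [lt_mem_nhds hy] with t ht
    simp [max_eq_left ht.le]

/-- Monotonicity of the shock layer: a profile `S₁` solving `(A(S₁))' = Δ^{α/2} S₁` and
connecting `u₋` (at `−∞`) to `u₊` (at `+∞`) with `u₋ > u₊` satisfies `S₁' ≤ 0`. -/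
theorem shock_layer_monotone
    (α cα : ℝ) (hα1 : 1 < α) (hα2 : α < 2) (hcα : 0 < cα)
    (A : ℝ → ℝ) (hA : ContDiff ℝ (⊤ : ℕ∞) A) (hAconv : ∀ u : ℝ, 0 < iteratedDeriv 2 A u)
    (umn upl : ℝ) (hu : upl < umn)
    (S₁ : ℝ → ℝ) (hS₁reg : ContDiff ℝ 3 S₁)
    (hS₁bdd : ∃ M : ℝ, ∀ x : ℝ,
      |S₁ x| ≤ M ∧ |deriv S₁ x| ≤ M ∧ |iteratedDeriv 2 S₁ x| ≤ M ∧ |iteratedDeriv 3 S₁ x| ≤ M)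
    (hS₁derivL1 : Integrable (deriv S₁) volume)
    (hS₁derivTop : Tendsto (deriv S₁) atTop (nhds 0))
    (hS₁derivBot : Tendsto (deriv S₁) atBot (nhds 0))
    (hS₁eq : ∀ x : ℝ, deriv (fun y => A (S₁ y)) x = fracLap cα α S₁ x)
    (hS₁bot : Tendsto S₁ atBot (nhds umn)) (hS₁top : Tendsto S₁ atTop (nhds upl))
    (hGagliardo : Integrable
      (fun p : ℝ × ℝ =>
        (max (deriv S₁ p.1) 0 - max (deriv S₁ p.2) 0) ^ 2 / |p.1 - p.2| ^ (1 + α)) volume)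
    (hL1 : Integrable (fun x => max (deriv S₁ x) 0 * fracLap cα α (deriv S₁) x) volume)
    (hker : Integrable
      (fun p : ℝ × ℝ => max (deriv S₁ p.1) 0 *
        (deriv S₁ (p.1 + p.2) + deriv S₁ (p.1 - p.2) - 2 * deriv S₁ p.1) / |p.2| ^ (1 + α))
      volume) :
    ∀ x : ℝ, deriv S₁ x ≤ 0 := by
  obtain ⟨M, hM⟩ := hS₁bdd
  set v : ℝ → ℝ := deriv S₁
  have hit2 : iteratedDeriv 2 S₁ = deriv v := by
    rw [iteratedDeriv_succ, iteratedDeriv_one]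
  have hit3 : iteratedDeriv 3 S₁ = deriv (deriv v) := by
    rw [iteratedDeriv_succ, hit2]
  have hS : ∀ x, HasDerivAt S₁ (v x) x := fun x =>
    (hS₁reg.differentiable (by norm_num) x).hasDerivAt
  have hv' : ∀ x, HasDerivAt v (deriv v x) x := fun x => by
    have h := hS₁reg.differentiable_iteratedDeriv 1 (by norm_num)
    rw [iteratedDeriv_one] at h
    exact (h x).hasDerivAt
  have hv'' : ∀ x, HasDerivAt (deriv v) (deriv (deriv v) x) x := fun x => by
    have h := hS₁reg.differentiable_iteratedDeriv 2 (by norm_num)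
    rw [hit2] at h
    exact (h x).hasDerivAt
  have hA1 : ∀ y, HasDerivAt A (deriv A y) y := fun y =>
    (hA.differentiable (by simp) y).hasDerivAt
  have hA2 : ∀ y, HasDerivAt (deriv A) (iteratedDeriv 2 A y) y := fun y => by
    have h := hA.differentiable_iteratedDeriv 1 (by exact_mod_cast WithTop.coe_lt_top _)
    rw [iteratedDeriv_one] at h
    rw [iteratedDeriv_succ, iteratedDeriv_one]
    exact (h y).hasDerivAt
  have hA2c : Continuous (iteratedDeriv 2 A) :=
    hA.continuous_iteratedDeriv 2 (WithTop.coe_le_coe.mpr le_top)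
  have hA1c : Continuous (deriv A) := continuous_iff_continuousAt.mpr fun y => (hA2 y).continuousAt
  have hSc : Continuous S₁ := hS₁reg.continuous
  have hvc : Continuous v := continuous_iff_continuousAt.mpr fun y => (hv' y).continuousAt
  have hAS : ∀ x, HasDerivAt (fun y => deriv A (S₁ y)) (iteratedDeriv 2 A (S₁ x) * v x) x :=
    fun x => (hA2 (S₁ x)).comp x (hS x)
  -- the differentiated profile equation
  have hlap : ∀ x, fracLap cα α v x =
      iteratedDeriv 2 A (S₁ x) * v x * v x + deriv A (S₁ x) * deriv v x := fun x => by
    have hfun : fracLap cα α S₁ = fun y => deriv A (S₁ y) * v y := funext fun y => by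
      rw [← hS₁eq y]
      exact ((hA1 (S₁ y)).comp y (hS y)).deriv
    have h := hasDerivAt_fracLap (cα := cα) (by linarith) hα2 hS hv' hv'' (fun y => (hM y).1)
      (fun y => (hM y).2.1) (fun y => hit2 ▸ (hM y).2.2.1) (fun y => hit3 ▸ (hM y).2.2.2) x
    rw [hfun] at h
    exact h.unique ((hAS x).mul (hv' x))
  have hposc : Continuous fun x => max (v x) 0 := hvc.max continuous_const
  have hposM : ∀ x, |max (v x) 0| ≤ M := fun x => by
    rw [abs_of_nonneg (le_max_right _ _)]
    exact max_le ((le_abs_self _).trans (hM x).2.1) ((abs_nonneg _).trans (hM x).1)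
  have hpos1 : Integrable fun x => max (v x) 0 := hS₁derivL1.pos_part
  have hpos2 : Integrable fun x => max (v x) 0 ^ 2 := by
    simp_rw [sq]
    exact hpos1.bdd_mul hposc.aestronglyMeasurable (ae_of_all _ hposM)
  have hpos3 : Integrable fun x => max (v x) 0 ^ 3 := by
    simp_rw [pow_succ _ 2, mul_comm (_ ^ 2)]
    exact hpos2.bdd_mul hposc.aestronglyMeasurable (ae_of_all _ hposM)
  obtain ⟨K, hK⟩ := (isCompact_Icc (a := -M) (b := M)).exists_bound_of_continuousOn
    hA2c.continuousOn
  have hcube : Integrable fun x => iteratedDeriv 2 A (S₁ x) * max (v x) 0 ^ 3 :=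
    hpos3.bdd_mul (hA2c.comp hSc).aestronglyMeasurable
      (ae_of_all _ fun x => hK _ (abs_le.mp (hM x).1))
  -- the pairing of `v₊` with the equation is a cubic term plus an exact derivative
  have hH : ∀ x, HasDerivAt (fun y => deriv A (S₁ y) * max (v y) 0 ^ 2 / 2)
      (max (v x) 0 * fracLap cα α v x - iteratedDeriv 2 A (S₁ x) * max (v x) 0 ^ 3 / 2) x :=
    fun x => by
      have h := ((hAS x).mul ((hasDerivAt_max_zero_sq (v x)).comp x (hv' x))).div_const 2
      refine h.congr_deriv ?_
      rw [hlap x]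
      simp only [Function.comp_apply]
      rcases max_cases (v x) 0 with ⟨hx, -⟩ | ⟨hx, -⟩ <;> rw [hx] <;> ring
  have htend : ∀ {l : Filter ℝ} {s : ℝ}, Tendsto S₁ l (nhds s) → Tendsto v l (nhds 0) →
      Tendsto (fun y => deriv A (S₁ y) * max (v y) 0 ^ 2 / 2) l (nhds 0) := fun {l s} hs hvl => by
    have hmax : Tendsto (fun y => max (v y) 0) l (nhds 0) := by
      simpa using hvl.max (tendsto_const_nhds (x := (0 : ℝ)))
    simpa using (((hA1c.tendsto s).comp hs).mul (hmax.pow 2)).div_const 2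
  have hzero := integral_of_hasDerivAt_of_tendsto hH (hL1.sub (hcube.div_const 2))
    (htend hS₁bot hS₁derivBot) (htend hS₁top hS₁derivTop)
  rw [integral_sub hL1 (hcube.div_const 2), integral_div, sub_self] at hzero
  have hle := integral_posPart_mul_fracLap_nonpos hcα.le hpos2 hker
  have hnn : ∀ x, 0 ≤ iteratedDeriv 2 A (S₁ x) * max (v x) 0 ^ 3 := fun x =>
    mul_nonneg (hAconv _).le (pow_nonneg (le_max_right _ _) 3)
  have hae := (integral_eq_zero_iff_of_nonneg hnn hcube).mp
    (le_antisymm (by linarith) (integral_nonneg hnn))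
  have heq := (Continuous.ae_eq_iff_eq volume ((hA2c.comp hSc).mul (hposc.pow 3))
    continuous_zero).mp hae
  intro x
  have hx : iteratedDeriv 2 A (S₁ x) * max (v x) 0 ^ 3 = 0 := congrFun heq x
  have hx0 := (mul_eq_zero.mp hx).resolve_left (hAconv _).ne'
  exact max_eq_right_iff.mp (pow_eq_zero_iff three_ne_zero |>.mp hx0)
end

section
/- Let 1 < α < 2 and let g : ℝ → ℝ be a bounded C² function with bounded second derivative. Assume that g₊ · Δ^{α/2}g ∈ L¹(ℝ), that (x,z) ↦ g₊(x)(g(x+z) + g(x−z) − 2g(x))|z|^{−1−α} is absolutely integrable on ℝ², and that ∬_{ℝ²} |g₊(x) − g₊(y)| · |g(x) − g(y)| · |x−y|^{−1−α} dx dy < ∞. Then ∫_ℝ g₊(x) Δ^{α/2}g(x) dx ≤ 0. -/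
open MeasureTheory Real Filter
open scoped ENNReal NNReal

/-- The second difference of a bounded continuous function has integral zero as soon as it is
integrable (positive step). -/
theorem integral_secondDiff_eq_zero_of_pos {P : ℝ → ℝ} (hP : Continuous P) {M : ℝ}
    (hM : ∀ x, |P x| ≤ M) {z : ℝ} (hz : 0 < z)
    (hint : Integrable (fun x => P (x + z) + P (x - z) - 2 * P x)) :
    ∫ x, (P (x + z) + P (x - z) - 2 * P x) = 0 := by
  set q : ℝ → ℝ := fun x => P (x + z) + P (x - z) - 2 * P x with hq
  have hii : ∀ a b, IntervalIntegrable P volume a b := fun a b => hP.intervalIntegrable a b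
  set Φ : ℝ → ℝ := fun t => ∫ x in (0 : ℝ)..t, P x with hΦ
  have hΦsub : ∀ a b, ∫ x in a..b, P x = Φ b - Φ a := fun a b =>
    (intervalIntegral.integral_interval_sub_left (hii 0 b) (hii 0 a)).symm
  have hinc : ∀ t, |Φ (t + z) - Φ t| ≤ M * z := by
    intro t
    rw [← hΦsub]
    have h := intervalIntegral.norm_integral_le_of_norm_le_const (a := t) (b := t + z)
      (f := P) (C := M) (fun x _ => by simpa using hM x)
    simpa [abs_of_pos hz] using h
  have hqi : ∀ a b, ∫ x in a..b, q x =
      Φ (b + z) - Φ (a + z) + (Φ (b - z) - Φ (a - z)) - 2 * (Φ b - Φ a) := by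
    intro a b
    have h1 : IntervalIntegrable (fun x => P (x + z)) volume a b :=
      (hP.comp (continuous_id.add continuous_const)).intervalIntegrable a b
    have h2 : IntervalIntegrable (fun x => P (x - z)) volume a b :=
      (hP.comp (continuous_id.sub continuous_const)).intervalIntegrable a b
    rw [hq, intervalIntegral.integral_sub (h1.add h2) ((hii a b).const_mul 2),
      intervalIntegral.integral_add h1 h2, intervalIntegral.integral_const_mul,
      intervalIntegral.integral_comp_add_right, intervalIntegral.integral_comp_sub_right,
      hΦsub, hΦsub, hΦsub]
  have hkz : Tendsto (fun k : ℕ => (k : ℝ) * z) atTop atTop :=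
    tendsto_natCast_atTop_atTop.atTop_mul_const hz
  have hlim : Tendsto (fun k : ℕ => ∫ x in (-((k : ℝ) * z))..((k : ℝ) * z), q x) atTop
      (nhds (∫ x, q x)) :=
    intervalIntegral_tendsto_integral hint (tendsto_neg_atTop_atBot.comp hkz) hkz
  have hsum : ∀ n : ℕ, ∑ k ∈ Finset.range n, ∫ x in (-((k : ℝ) * z))..((k : ℝ) * z), q x =
      (Φ (n * z) - Φ (n * z - z)) - (Φ 0 - Φ (-z)) -
        ((Φ (0 + z) - Φ 0) - (Φ (-(n * z) + z) - Φ (-(n * z)))) := by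
    intro n
    induction n with
    | zero => simp
    | succ n ih =>
      rw [Finset.sum_range_succ, ih, hqi]
      push_cast
      have e1 : ((n : ℝ) + 1) * z - z = n * z := by ring
      have e2 : -(((n : ℝ) + 1) * z) + z = -(n * z) := by ring
      have e3 : ((n : ℝ) + 1) * z = n * z + z := by ring
      have e4 : -((n : ℝ) * z + z) = -(n * z) - z := by ring
      rw [e1, e2, e3, e4]
      ring
  have hbdd : ∀ n : ℕ, |∑ k ∈ Finset.range n,
      ∫ x in (-((k : ℝ) * z))..((k : ℝ) * z), q x| ≤ 4 * (M * z) := by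
    intro n
    rw [hsum]
    have h1 := abs_le.mp (hinc (n * z - z))
    have h2 := abs_le.mp (hinc (-z))
    have h3 := abs_le.mp (hinc 0)
    have h4 := abs_le.mp (hinc (-(n * z)))
    rw [sub_add_cancel] at h1
    rw [neg_add_cancel] at h2
    rw [abs_le]
    constructor <;> linarith [h1.1, h1.2, h2.1, h2.2, h3.1, h3.2, h4.1, h4.2]
  have hzero : Tendsto (fun n : ℕ => (n : ℝ)⁻¹ * ∑ k ∈ Finset.range n,
      ∫ x in (-((k : ℝ) * z))..((k : ℝ) * z), q x) atTop (nhds 0) := by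
    refine squeeze_zero_norm (a := fun n : ℕ => (n : ℝ)⁻¹ * (4 * (M * z))) (fun n => ?_) ?_
    · rw [norm_mul, Real.norm_of_nonneg (by positivity : (0 : ℝ) ≤ (n : ℝ)⁻¹)]
      exact mul_le_mul_of_nonneg_left (hbdd n) (by positivity)
    · simpa using (tendsto_inv_atTop_nhds_zero_nat (𝕜 := ℝ)).mul_const (4 * (M * z))
  exact tendsto_nhds_unique hlim.cesaro hzero

/-- The second difference of a bounded continuous function has integral zero as soon as it is
integrable. -/
theorem integral_secondDiff_eq_zero {P : ℝ → ℝ} (hP : Continuous P) {M : ℝ}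
    (hM : ∀ x, |P x| ≤ M) (z : ℝ)
    (hint : Integrable (fun x => P (x + z) + P (x - z) - 2 * P x)) :
    ∫ x, (P (x + z) + P (x - z) - 2 * P x) = 0 := by
  rcases lt_trichotomy z 0 with hz | rfl | hz
  · have e : (fun x => P (x + z) + P (x - z) - 2 * P x) =
        fun x => P (x + -z) + P (x - -z) - 2 * P x := by
      funext x
      rw [sub_neg_eq_add, ← sub_eq_add_neg]
      ring
    rw [e] at hint ⊢
    exact integral_secondDiff_eq_zero_of_pos hP hM (neg_pos.mpr hz) hint
  · have e : (fun x => P (x + 0) + P (x - 0) - 2 * P x) = fun _ => 0 := by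
      funext x
      rw [add_zero, sub_zero]
      ring
    rw [e, integral_zero]
  · exact integral_secondDiff_eq_zero_of_pos hP hM hz hint

/-- Up to half the increment of the squared positive part, the product of the positive part with
the increment is controlled by the Gagliardo density. -/
theorem abs_posPart_mul_sub_le (a b : ℝ) :
    |max a 0 * (b - a) - (max b 0 ^ 2 - max a 0 ^ 2) / 2| ≤
      |max a 0 - max b 0| * |a - b| := by
  rw [← abs_mul, abs_le]
  rcases le_total a 0 with ha | ha <;> rcases le_total b 0 with hb | hb <;>
    simp only [max_eq_left, max_eq_right, ha, hb]
  · simp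
  · rw [abs_of_nonneg (by nlinarith)]
    constructor <;> nlinarith
  · rw [abs_of_nonneg (by nlinarith)]
    constructor <;> nlinarith
  · rw [abs_of_nonneg (by nlinarith)]
    constructor <;> nlinarith [sq_nonneg (a - b)]

theorem posPart_sub_mul_sub_nonneg (a b : ℝ) : 0 ≤ (max a 0 - max b 0) * (a - b) := by
  rcases le_total a b with h | h
  · exact mul_nonneg_of_nonpos_of_nonpos (sub_nonpos.mpr (max_le_max_right 0 h))
      (sub_nonpos.mpr h)
  · exact mul_nonneg (sub_nonneg.mpr (max_le_max_right 0 h)) (sub_nonneg.mpr h)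

/-- Testing the second difference of a bounded continuous function against its positive part
gives a nonpositive quantity, for each fixed step. -/
theorem integral_posPart_mul_secondDiff_nonpos {g : ℝ → ℝ} (hg : Continuous g) {M : ℝ}
    (hM : ∀ x, |g x| ≤ M) (z : ℝ)
    (hh : Integrable (fun x => max (g x) 0 * (g (x + z) + g (x - z) - 2 * g x)))
    (hG : Integrable (fun x => |max (g x) 0 - max (g (x + z)) 0| * |g x - g (x + z)|)) :
    ∫ x, max (g x) 0 * (g (x + z) + g (x - z) - 2 * g x) ≤ 0 := by
  set P : ℝ → ℝ := fun x => max (g x) 0 ^ 2 with hPdef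
  set G : ℝ → ℝ := fun x => |max (g x) 0 - max (g (x + z)) 0| * |g x - g (x + z)| with hGdef
  set e : ℝ → ℝ := fun x => max (g x) 0 * (g (x + z) - g x) - (P (x + z) - P x) / 2 with hedef
  have hP : Continuous P := by fun_prop
  have hPM : ∀ x, |P x| ≤ M ^ 2 := by
    intro x
    have h : max (g x) 0 ≤ M :=
      max_le ((le_abs_self _).trans (hM x)) ((abs_nonneg _).trans (hM x))
    rw [abs_of_nonneg (sq_nonneg _)]
    exact pow_le_pow_left₀ (le_max_right _ _) h 2
  have he : Integrable e := by
    refine hG.mono' (by fun_prop) (ae_of_all _ fun x => ?_)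
    exact abs_posPart_mul_sub_le (g x) (g (x + z))
  have he' : Integrable (fun x => e (x - z)) := he.comp_sub_right z
  have hG' : Integrable (fun x => G (x - z)) := hG.comp_sub_right z
  have hdec : ∀ x, P (x + z) + P (x - z) - 2 * P x =
      2 * (max (g x) 0 * (g (x + z) + g (x - z) - 2 * g x) - (e x - e (x - z)) + G (x - z)) := by
    intro x
    have hGx : G (x - z) = (max (g (x - z)) 0 - max (g x) 0) * (g (x - z) - g x) := by
      simp only [hGdef, sub_add_cancel]
      rw [← abs_mul, abs_of_nonneg (posPart_sub_mul_sub_nonneg _ _)]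
    rw [hGx]
    simp only [hedef, sub_add_cancel]
    ring
  have hd : Integrable (fun x => e x - e (x - z)) := he.sub he'
  have hs : Integrable (fun x =>
      max (g x) 0 * (g (x + z) + g (x - z) - 2 * g x) - (e x - e (x - z))) := hh.sub hd
  have hzero := integral_secondDiff_eq_zero hP hPM z
    (by simp only [hdec]; exact (hs.add hG').const_mul 2)
  simp only [hdec] at hzero
  rw [integral_const_mul, integral_add hs hG', integral_sub hh hd,
    integral_sub he he', integral_sub_right_eq_self e z] at hzero
  have hGnn : 0 ≤ ∫ x, G (x - z) := integral_nonneg fun x => by positivity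
  linarith

/-- Testing the fractional Laplacian of `g` against the positive part of `g`
gives a nonpositive quantity: `∫ g₊ Δ^{α/2} g dx ≤ 0`. -/
theorem integral_posPart_fracLap_nonpos
    (α cα : ℝ) (hα1 : 1 < α) (hα2 : α < 2) (hcα : 0 < cα)
    (g : ℝ → ℝ) (hgreg : ContDiff ℝ 2 g)
    (hgbdd : ∃ M : ℝ, ∀ x : ℝ, |g x| ≤ M ∧ |iteratedDeriv 2 g x| ≤ M)
    (hL1 : Integrable (fun x => max (g x) 0 * fracLap cα α g x) volume)
    (hker : Integrable
      (fun p : ℝ × ℝ =>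
        max (g p.1) 0 * (g (p.1 + p.2) + g (p.1 - p.2) - 2 * g p.1) / |p.2| ^ (1 + α)) volume)
    (hGagliardo : Integrable
      (fun p : ℝ × ℝ =>
        |max (g p.1) 0 - max (g p.2) 0| * |g p.1 - g p.2| / |p.1 - p.2| ^ (1 + α)) volume) :
    (∫ x : ℝ, max (g x) 0 * fracLap cα α g x) ≤ 0 := by
  obtain ⟨M, hM⟩ := hgbdd
  have hg : Continuous g := hgreg.continuous
  have hswap : (∫ x : ℝ, max (g x) 0 * fracLap cα α g x) = (cα / 2) * ∫ z : ℝ, ∫ x : ℝ,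
      max (g x) 0 * (g (x + z) + g (x - z) - 2 * g x) / |z| ^ (1 + α) := by
    rw [← integral_integral_swap hker, ← integral_const_mul]
    refine integral_congr_ae (ae_of_all _ fun x => ?_)
    simp only [fracLap, mul_div_assoc, integral_const_mul]
    ring
  have hG : Integrable (fun p : ℝ × ℝ =>
      |max (g p.1) 0 - max (g (p.1 + p.2)) 0| * |g p.1 - g (p.1 + p.2)| /
        |p.2| ^ (1 + α)) := by
    have h := (measurePreserving_prod_add (volume : Measure ℝ)
      (volume : Measure ℝ)).integrable_comp_of_integrable hGagliardo
    refine h.congr (ae_of_all _ fun p => ?_)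
    simp
  rw [hswap]
  refine mul_nonpos_of_nonneg_of_nonpos (by positivity) (integral_nonpos_of_ae ?_)
  have hne : ∀ᵐ z : ℝ, z ≠ 0 := Measure.ae_ne volume 0
  filter_upwards [hker.prod_left_ae, hG.prod_left_ae, hne] with z hz1 hz2 hz0
  have hk : |z| ^ (1 + α) ≠ 0 := (Real.rpow_pos_of_pos (abs_pos.mpr hz0) _).ne'
  have hz1' := hz1.mul_const (|z| ^ (1 + α))
  have hz2' := hz2.mul_const (|z| ^ (1 + α))
  simp only [div_mul_cancel₀ _ hk] at hz1' hz2'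
  have hmain := integral_posPart_mul_secondDiff_nonpos hg (fun x => (hM x).1) z hz1' hz2'
  simp only [integral_div, Pi.zero_apply]
  exact div_nonpos_of_nonpos_of_nonneg hmain (by positivity)
end

section
/- Let A : ℝ → ℝ be C² with A''(u) > 0 for all u. Define the normalized relative entropy flux f(u,v) = F(u,v)/η(u|v) for u ≠ v and f(v,v) = A'(v). Then for every L > 0 there exists Λ > 0 such that for all u, u₁, u₂, v, v₁, v₂ ∈ [−L, L]: (i) if u₁ ≤ u₂ then 0 ≤ f(u₂, v) − f(u₁, v) ≤ Λ (u₂ − u₁); (ii) if v₁ ≤ v₂ then f(u, v₂) − f(u, v₁) ≥ (v₂ − v₁)/Λ. (Equivalently: f is nondecreasing and Lipschitz in its first variable, and strictly increasing in its second variable with a uniform lower Lipschitz bound, on compact sets.) -/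
open MeasureTheory Real Filter
open scoped ENNReal NNReal

/-- The entropy flux `G` associated with the quadratic entropy `η(u) = u²/2` and the
flux `A`, characterized by `G'(u) = u A'(u)` (normalized by `G(0) = 0`). -/
noncomputable def entFlux (A : ℝ → ℝ) (u : ℝ) : ℝ := ∫ s in (0 : ℝ)..u, s * deriv A s

/-- The relative entropy flux `F(u,v) = G(u) − G(v) − v (A(u) − A(v))`. -/
noncomputable def relEntFlux (A : ℝ → ℝ) (u v : ℝ) : ℝ :=
  entFlux A u - entFlux A v - v * (A u - A v)

/-- The normalized relative entropy flux `f(u,v) = F(u,v)/η(u|v)` for `u ≠ v`,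
extended by `f(v,v) = A'(v)`, where `η(u|v) = (u−v)²/2`. -/
noncomputable def normRelEntFlux (A : ℝ → ℝ) (u v : ℝ) : ℝ :=
  if u = v then deriv A v else relEntFlux A u v / ((u - v) ^ 2 / 2)

/-- The normalized relative entropy flux is a weighted average of `A'` over the segment
from `v` to `u`. -/
lemma normRelEntFlux_eq_integral {A : ℝ → ℝ} (hA : ContDiff ℝ 1 A) (u v : ℝ) :
    normRelEntFlux A u v = ∫ t in (0 : ℝ)..1, 2 * t * deriv A (v + t * (u - v)) := by
  have hA' : Continuous (deriv A) := hA.continuous_deriv le_rfl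
  unfold normRelEntFlux
  split_ifs with h
  · subst h
    have h2 : ∫ x in (0 : ℝ)..1, 2 * x = 1 := by
      rw [intervalIntegral.integral_const_mul, integral_id]
      norm_num
    simp [h2]
  have hd : ∀ s, HasDerivAt A (deriv A s) s := fun s =>
    (hA.differentiable one_ne_zero s).hasDerivAt
  have hG : ∀ s, HasDerivAt (entFlux A) (s * deriv A s) s := fun s =>
    (continuous_id.mul hA').integral_hasStrictDerivAt 0 s |>.hasDerivAt
  have hline : ∀ t, HasDerivAt (fun t : ℝ => v + t * (u - v)) (u - v) t := fun t => by
    simpa using ((hasDerivAt_id t).mul_const (u - v)).const_add v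
  have hH : ∀ t, HasDerivAt
      (fun t : ℝ => entFlux A (v + t * (u - v)) - v * A (v + t * (u - v)))
      ((u - v) ^ 2 / 2 * (2 * t * deriv A (v + t * (u - v)))) t := fun t => by
    refine (((hG _).comp t (hline t)).sub (((hd _).comp t (hline t)).const_mul v)).congr_deriv ?_
    ring
  have key := intervalIntegral.integral_eq_sub_of_hasDerivAt (a := 0) (b := 1)
    (fun t _ => hH t) (Continuous.intervalIntegrable (by fun_prop) _ _)
  rw [intervalIntegral.integral_const_mul] at key
  have hne : (u - v) ^ 2 / 2 ≠ 0 := by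
    have := sub_ne_zero.mpr h
    positivity
  rw [div_eq_iff hne, mul_comm, key, relEntFlux]
  simp only [one_mul, zero_mul, add_zero, add_sub_cancel]
  ring

/-- The derivative of a `C²` function with positive second derivative is bi-Lipschitz increasing
on compact intervals. -/
lemma exists_bounds_deriv_sub_deriv {A : ℝ → ℝ} (hA : ContDiff ℝ 2 A)
    (hAconv : ∀ u : ℝ, 0 < iteratedDeriv 2 A u) {a b : ℝ} (hab : a ≤ b) :
    ∃ m M : ℝ, 0 < m ∧ 0 < M ∧ ∀ x ∈ Set.Icc a b, ∀ y ∈ Set.Icc a b, x ≤ y →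
      m * (y - x) ≤ deriv A y - deriv A x ∧ deriv A y - deriv A x ≤ M * (y - x) := by
  have hcont : Continuous (iteratedDeriv 2 A) := hA.continuous_iteratedDeriv 2 le_rfl
  have hdiff : Differentiable ℝ (deriv A) := by
    have := hA.differentiable_iteratedDeriv 1 (by norm_num)
    rwa [iteratedDeriv_one] at this
  have hdd : deriv (deriv A) = iteratedDeriv 2 A := by
    rw [iteratedDeriv_succ, iteratedDeriv_one]
  obtain ⟨p, -, hp⟩ := isCompact_Icc.exists_isMinOn (Set.nonempty_Icc.mpr hab) hcont.continuousOn
  obtain ⟨q, -, hq⟩ := isCompact_Icc.exists_isMaxOn (Set.nonempty_Icc.mpr hab) hcont.continuousOn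
  refine ⟨_, _, hAconv p, hAconv q, fun x hx y hy hxy => ⟨?_, ?_⟩⟩
  · refine (convex_Icc a b).mul_sub_le_image_sub_of_le_deriv hdiff.continuous.continuousOn
      hdiff.differentiableOn (fun z hz => ?_) x hx y hy hxy
    rw [hdd]
    exact hp (interior_subset hz)
  · refine (convex_Icc a b).image_sub_le_mul_sub_of_deriv_le hdiff.continuous.continuousOn
      hdiff.differentiableOn (fun z hz => ?_) x hx y hy hxy
    rw [hdd]
    exact hq (interior_subset hz)

/-- On compact sets, the normalized relative entropy flux `f` is nondecreasing and
Lipschitz in its first variable, and increasing in its second variable with a uniform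
lower Lipschitz bound. -/
theorem normRelEntFlux_monotonicity
    (A : ℝ → ℝ) (hA : ContDiff ℝ 2 A) (hAconv : ∀ u : ℝ, 0 < iteratedDeriv 2 A u) :
    ∀ L : ℝ, 0 < L → ∃ Λ : ℝ, 0 < Λ ∧
      ∀ u u₁ u₂ v v₁ v₂ : ℝ,
        u ∈ Set.Icc (-L) L → u₁ ∈ Set.Icc (-L) L → u₂ ∈ Set.Icc (-L) L →
        v ∈ Set.Icc (-L) L → v₁ ∈ Set.Icc (-L) L → v₂ ∈ Set.Icc (-L) L →
        (u₁ ≤ u₂ →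
          0 ≤ normRelEntFlux A u₂ v - normRelEntFlux A u₁ v ∧
            normRelEntFlux A u₂ v - normRelEntFlux A u₁ v ≤ Λ * (u₂ - u₁)) ∧
        (v₁ ≤ v₂ →
          (v₂ - v₁) / Λ ≤ normRelEntFlux A u v₂ - normRelEntFlux A u v₁) := by
  intro L hL
  obtain ⟨m, M, hm, hM, hmM⟩ := exists_bounds_deriv_sub_deriv hA hAconv (neg_le_self hL.le)
  have hA1 : ContDiff ℝ 1 A := hA.of_le (by norm_num)
  have hA' : Continuous (deriv A) := hA1.continuous_deriv le_rfl
  have hint : ∀ u v : ℝ, IntervalIntegrable (fun t => 2 * t * deriv A (v + t * (u - v)))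
      volume 0 1 := fun u v => Continuous.intervalIntegrable (by fun_prop) _ _
  have hseg : ∀ u v t : ℝ, u ∈ Set.Icc (-L) L → v ∈ Set.Icc (-L) L → t ∈ Set.Icc (0 : ℝ) 1 →
      v + t * (u - v) ∈ Set.Icc (-L) L := fun u v t hu hv ht =>
    (convex_Icc (-L) L).add_smul_sub_mem hv hu ht
  refine ⟨2 * M + 3 / m, by positivity, ?_⟩
  intro u u₁ u₂ v v₁ v₂ hu hu₁ hu₂ hv hv₁ hv₂
  simp only [normRelEntFlux_eq_integral hA1]
  rw [← intervalIntegral.integral_sub (hint _ _) (hint _ _),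
    ← intervalIntegral.integral_sub (hint _ _) (hint _ _)]
  refine ⟨fun h => ?_, fun h => ?_⟩
  · have hb : ∀ t ∈ Set.Icc (0 : ℝ) 1,
        0 ≤ 2 * t * deriv A (v + t * (u₂ - v)) - 2 * t * deriv A (v + t * (u₁ - v)) ∧
        2 * t * deriv A (v + t * (u₂ - v)) - 2 * t * deriv A (v + t * (u₁ - v)) ≤
          2 * M * (u₂ - u₁) := fun t ht => by
      have hd : 0 ≤ u₂ - u₁ := sub_nonneg.mpr h
      have ht0 := ht.1
      obtain ⟨h₁, h₂⟩ := hmM _ (hseg u₁ v t hu₁ hv ht) _ (hseg u₂ v t hu₂ hv ht) (by gcongr)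
      have e : v + t * (u₂ - v) - (v + t * (u₁ - v)) = t * (u₂ - u₁) := by ring
      rw [e] at h₁ h₂
      rw [← mul_sub]
      have h₀ : 0 ≤ m * (t * (u₂ - u₁)) := by positivity
      refine ⟨mul_nonneg (by positivity) (h₀.trans h₁), ?_⟩
      calc _ ≤ 2 * t * (M * (t * (u₂ - u₁))) := by gcongr
        _ ≤ 2 * 1 * (M * (1 * (u₂ - u₁))) := by gcongr <;> exact ht.2
        _ = _ := by ring
    refine ⟨intervalIntegral.integral_nonneg zero_le_one fun t ht => (hb t ht).1, ?_⟩
    have hle := intervalIntegral.integral_mono_on zero_le_one ((hint u₂ v).sub (hint u₁ v))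
      intervalIntegrable_const (fun t ht => (hb t ht).2)
    rw [intervalIntegral.integral_const, sub_zero, one_smul] at hle
    refine hle.trans (mul_le_mul_of_nonneg_right ?_ (sub_nonneg.mpr h))
    exact le_add_of_nonneg_right (by positivity)
  · have hd : 0 ≤ v₂ - v₁ := sub_nonneg.mpr h
    have hle : ∫ t in (0 : ℝ)..1, 2 * m * (v₂ - v₁) * (t - t ^ 2) ≤ _ :=
      intervalIntegral.integral_mono_on zero_le_one
      (Continuous.intervalIntegrable (by fun_prop) _ _)
      ((hint u v₂).sub (hint u v₁)) (fun t ht => by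
        have ht0 := ht.1
        have ht1 : 0 ≤ 1 - t := sub_nonneg.mpr ht.2
        have e : v₂ + t * (u - v₂) - (v₁ + t * (u - v₁)) = (1 - t) * (v₂ - v₁) := by ring
        have h₁ := (hmM _ (hseg u v₁ t hu hv₁ ht) _ (hseg u v₂ t hu hv₂ ht)
          (sub_nonneg.mp (e ▸ mul_nonneg ht1 hd))).1
        rw [e] at h₁
        rw [← mul_sub]
        calc _ = 2 * t * (m * ((1 - t) * (v₂ - v₁))) := by ring
          _ ≤ _ := by gcongr)
    refine le_trans ?_ hle
    have hI : ∫ t in (0 : ℝ)..1, (t - t ^ 2) = 1 / 6 := by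
      rw [intervalIntegral.integral_sub (Continuous.intervalIntegrable (by fun_prop) _ _)
        (Continuous.intervalIntegrable (by fun_prop) _ _), integral_id, integral_pow]
      norm_num
    rw [intervalIntegral.integral_const_mul, hI]
    calc (v₂ - v₁) / (2 * M + 3 / m) ≤ (v₂ - v₁) / (3 / m) := by
          gcongr
          exact le_add_of_nonneg_left (by positivity)
      _ = 2 * m * (v₂ - v₁) * (1 / 6) := by
          field_simp
          ring
end

section
/- Let A : ℝ → ℝ be differentiable with derivative A', and define G : ℝ → ℝ by G'(u) = u A'(u), F(u,v) = G(u) − G(v) − v (A(u) − A(v)), and A(u|v) = A(u) − A(v) − A'(v)(u−v). Let v, S : ℝ → ℝ be differentiable functions. Then for every x ∈ ℝ, −(d/dx)[ F(v(x), S(x)) ] − S'(x) A(v(x)|S(x)) = −(v(x) − S(x)) (d/dx)[ A(v(x)) ] + (v(x) − S(x)) (d/dx)[ A(S(x)) ]. -/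
open MeasureTheory Real Filter
open scoped ENNReal NNReal

/-- The relative flux `A(u|v) = A(u) − A(v) − A'(v)(u − v)`. -/
noncomputable def relFlux (A : ℝ → ℝ) (u v : ℝ) : ℝ := A u - A v - deriv A v * (u - v)

/-- The relative entropy flux `F(u,v) = G(u) − G(v) − v (A(u) − A(v))` built from an
entropy flux `G`. -/
noncomputable def relEntFluxOf (A G : ℝ → ℝ) (u v : ℝ) : ℝ :=
  G u - G v - v * (A u - A v)

/-- The pointwise identity
`−(d/dx)[F(v,S)] − S' A(v|S) = −(v − S)(d/dx)[A(v)] + (v − S)(d/dx)[A(S)]`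
underlying the relative entropy computation. -/
theorem relEntropy_flux_identity
    (A : ℝ → ℝ) (hA : Differentiable ℝ A)
    (G : ℝ → ℝ) (hG : ∀ u : ℝ, HasDerivAt G (u * deriv A u) u)
    (v S : ℝ → ℝ) (hv : Differentiable ℝ v) (hS : Differentiable ℝ S) :
    ∀ x : ℝ,
      -(deriv (fun y => relEntFluxOf A G (v y) (S y)) x)
          - deriv S x * relFlux A (v x) (S x)
        = -((v x - S x) * deriv (fun y => A (v y)) x)
            + (v x - S x) * deriv (fun y => A (S y)) x := by
  intro x
  have hv' := (hv x).hasDerivAt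
  have hS' := (hS x).hasDerivAt
  have hAv : HasDerivAt (fun y => A (v y)) (deriv A (v x) * deriv v x) x :=
    (hA (v x)).hasDerivAt.comp x hv'
  have hAS : HasDerivAt (fun y => A (S y)) (deriv A (S x) * deriv S x) x :=
    (hA (S x)).hasDerivAt.comp x hS'
  have hGv : HasDerivAt (fun y => G (v y)) (v x * deriv A (v x) * deriv v x) x :=
    (hG (v x)).comp x hv'
  have hGS : HasDerivAt (fun y => G (S y)) (S x * deriv A (S x) * deriv S x) x :=
    (hG (S x)).comp x hS'
  have hF : HasDerivAt (fun y => relEntFluxOf A G (v y) (S y)) _ x :=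
    (hGv.sub hGS).sub (hS'.mul (hAv.sub hAS))
  rw [hF.deriv, hAv.deriv, hAS.deriv]
  simp only [relFlux]
  ring
end

section
/- Let 1 < α < 2, β = 1/(α−1), and let ε > 0, δ > 0. Let φ : ℝ → [0,1] be a smooth nondecreasing function with φ = 0 on (−∞,0] and φ = 1 on [1,∞), and φ_δ(x) = φ(x/δ). Let M > 0 and let w : ℝ → ℝ be a bounded C² function with bounded second derivative and |w| ≤ M. Assume that (x,z) ↦ φ_δ(|x|/ε^β)² w(x)(w(x+z) + w(x−z) − 2w(x))|z|^{−1−α} is absolutely integrable on ℝ², and that ∬_{ℝ²} (φ_δ(|x|/ε^β) w(x) − φ_δ(|y|/ε^β) w(y))² |x−y|^{−1−α} dx dy < ∞ and ∬_{ℝ²} (φ_δ(|x|/ε^β) − φ_δ(|y|/ε^β))² |x−y|^{−1−α} dx dy < ∞. Then there exists a constant C > 0, depending only on M, α, c_α, and φ (but not on ε and δ), such that ε ∫_ℝ φ_δ(|x|/ε^β)² w(x) Δ^{α/2}w(x) dx ≤ C δ^{−(α−1)}. -/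
open MeasureTheory Real Filter
open scoped ENNReal NNReal

/-- If `K` is continuous and square integrable and the increment `K - K (· - z)` is integrable,
then this increment has zero integral. -/
theorem integral_sub_comp_sub_eq_zero_of_pos {K : ℝ → ℝ} (hK : Continuous K)
    (hK2 : Integrable (fun x => K x ^ 2)) {z : ℝ} (hz : 0 < z)
    (hint : Integrable (fun x => K x - K (x - z))) :
    ∫ x, (K x - K (x - z)) = 0 := by
  have hneg : Tendsto (fun n : ℝ => -n) atTop atBot := tendsto_neg_atTop_atBot
  have hlim := intervalIntegral_tendsto_integral hint hneg tendsto_id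
  have hii : ∀ a b : ℝ, IntervalIntegrable K volume a b := fun a b => hK.intervalIntegrable a b
  have hii2 : ∀ a b : ℝ, IntervalIntegrable (fun x => K x ^ 2) volume a b :=
    fun a b => (hK.pow 2).intervalIntegrable a b
  have hcs : ∀ a : ℝ, (∫ x in (a - z)..a, K x) ^ 2 ≤ z * ∫ x in (a - z)..a, K x ^ 2 := by
    intro a
    set I := ∫ x in (a - z)..a, K x with hI
    have h0 : 0 ≤ ∫ x in (a - z)..a, (z * K x - I) ^ 2 :=
      intervalIntegral.integral_nonneg (by linarith) fun x _ => sq_nonneg _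
    have h1 : ∫ x in (a - z)..a, (z * K x - I) ^ 2
        = z ^ 2 * (∫ x in (a - z)..a, K x ^ 2) - 2 * z * I * I + z * I ^ 2 := by
      have : ∀ x, (z * K x - I) ^ 2 = z ^ 2 * K x ^ 2 - 2 * z * I * K x + I ^ 2 := by
        intro x; ring
      simp only [this]
      rw [intervalIntegral.integral_add
          (((hii2 _ _).const_mul _).sub ((hii _ _).const_mul _)) intervalIntegrable_const,
        intervalIntegral.integral_sub ((hii2 _ _).const_mul _) ((hii _ _).const_mul _),
        intervalIntegral.integral_const_mul, intervalIntegral.integral_const_mul, ← hI,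
        intervalIntegral.integral_const]
      simp
    rw [h1] at h0
    have h2 : 0 ≤ z * (z * (∫ x in (a - z)..a, K x ^ 2) - I ^ 2) := by
      linarith
    linarith [nonneg_of_mul_nonneg_right h2 hz]
  have hsq : ∀ {f : ℝ → ℝ}, Tendsto (fun n => ∫ x in (f n - z)..(f n), K x ^ 2) atTop (nhds 0) →
      Tendsto (fun n => ∫ x in (f n - z)..(f n), K x) atTop (nhds 0) := by
    intro f hf
    have h1 : Tendsto (fun n => (∫ x in (f n - z)..(f n), K x) ^ 2) atTop (nhds 0) := by
      refine squeeze_zero (fun n => sq_nonneg _) (fun n => hcs (f n)) ?_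
      simpa using hf.const_mul z
    have h2 := (Real.continuous_sqrt.tendsto 0).comp h1
    simp only [Real.sqrt_zero, Function.comp_def, Real.sqrt_sq_eq_abs] at h2
    exact (tendsto_zero_iff_abs_tendsto_zero _).2 h2
  have htop : Tendsto (fun n : ℝ => ∫ x in (n - z)..n, K x) atTop (nhds 0) := by
    apply hsq (f := fun n => n)
    have h1 := intervalIntegral_tendsto_integral hK2 hneg tendsto_id
    have h2 := intervalIntegral_tendsto_integral hK2 hneg
      (tendsto_atTop_add_const_right atTop (-z) tendsto_id)
    have h3 := h1.sub h2
    rw [sub_self] at h3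
    refine h3.congr fun n => ?_
    rw [intervalIntegral.integral_interval_sub_left (hii2 _ _) (hii2 _ _)]
    simp [sub_eq_add_neg]
  have hbot : Tendsto (fun n : ℝ => ∫ x in (-n - z)..(-n), K x) atTop (nhds 0) := by
    apply hsq (f := fun n => -n)
    have h1 := intervalIntegral_tendsto_integral hK2
      (tendsto_atBot_add_const_right atTop (-z) hneg) tendsto_id
    have h2 := intervalIntegral_tendsto_integral hK2 hneg tendsto_id
    have h3 := h1.sub h2
    rw [sub_self] at h3
    refine h3.congr fun n => ?_
    rw [sub_eq_iff_eq_add, ← sub_eq_add_neg,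
      intervalIntegral.integral_add_adjacent_intervals (hii2 _ _) (hii2 _ _)]
  have hdiff : ∀ n : ℝ, ∫ x in (-n)..n, (K x - K (x - z))
      = (∫ x in (n - z)..n, K x) - ∫ x in (-n - z)..(-n), K x := by
    intro n
    have hshift : IntervalIntegrable (fun x => K (x - z)) volume (-n) n :=
      Continuous.intervalIntegrable (by fun_prop) _ _
    rw [intervalIntegral.integral_sub (hii _ _) hshift,
      intervalIntegral.integral_comp_sub_right (fun x => K x) z,
      ← intervalIntegral.integral_add_adjacent_intervals (hii (-n) (n - z)) (hii (n - z) n),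
      ← intervalIntegral.integral_add_adjacent_intervals (hii (-n - z) (-n)) (hii (-n) (n - z))]
    ring
  have h0 := htop.sub hbot
  rw [sub_zero] at h0
  exact tendsto_nhds_unique hlim (h0.congr fun n => (hdiff n).symm)

theorem integral_sub_comp_sub_eq_zero {K : ℝ → ℝ} (hK : Continuous K)
    (hK2 : Integrable (fun x => K x ^ 2)) (z : ℝ)
    (hint : Integrable (fun x => K x - K (x - z))) :
    ∫ x, (K x - K (x - z)) = 0 := by
  rcases lt_trichotomy z 0 with hz | rfl | hz
  · have h := integral_sub_comp_sub_eq_zero_of_pos (K := fun x => K (x - z))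
      (hK.comp (continuous_id.sub continuous_const)) (hK2.comp_sub_right z)
      (z := -z) (by linarith) (hint.neg.congr (Eventually.of_forall fun x => by simp))
    simp only [sub_neg_eq_add, add_sub_cancel_right] at h
    rw [← neg_eq_zero, ← integral_neg]
    simpa using h
  · simp
  · exact integral_sub_comp_sub_eq_zero_of_pos hK hK2 hz hint

/-- Pointwise splitting of the energy of `w` tested against `ψ² w`, where `a`, `b` are the values
of `ψ` and `s`, `t` those of `w` at two points. -/
theorem localized_energy_identity (a b s t k : ℝ) :
    (a ^ 2 * s - b ^ 2 * t) * (s - t) / k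
      = (a * s - b * t) ^ 2 / k - s * t * ((a - b) ^ 2 / k) := by
  ring

/-- Nonlocal Caccioppoli inequality, in second-difference form. -/
theorem integral_second_difference_le {a M : ℝ} {ψ w : ℝ → ℝ} (hψ : Continuous ψ)
    (hw : Continuous w) (hψ1 : ∀ x, |ψ x| ≤ 1) (hwM : ∀ x, |w x| ≤ M)
    (hF : Integrable (fun p : ℝ × ℝ =>
      ψ p.1 ^ 2 * w p.1 * (w (p.1 + p.2) + w (p.1 - p.2) - 2 * w p.1) / |p.2| ^ a) volume)
    (hQ : Integrable (fun p : ℝ × ℝ =>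
      (ψ p.1 * w p.1 - ψ p.2 * w p.2) ^ 2 / |p.1 - p.2| ^ a) volume)
    (hR : Integrable (fun p : ℝ × ℝ => (ψ p.1 - ψ p.2) ^ 2 / |p.1 - p.2| ^ a) volume) :
    ∫ p : ℝ × ℝ,
      ψ p.1 ^ 2 * w p.1 * (w (p.1 + p.2) + w (p.1 - p.2) - 2 * w p.1) / |p.2| ^ a
      ≤ M ^ 2 * ∫ p : ℝ × ℝ, (ψ p.1 - ψ p.2) ^ 2 / |p.1 - p.2| ^ a := by
  have hwR : Integrable (fun p : ℝ × ℝ =>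
      w p.1 * w p.2 * ((ψ p.1 - ψ p.2) ^ 2 / |p.1 - p.2| ^ a)) volume := by
    refine hR.bdd_mul (c := M * M) (by fun_prop) (Eventually.of_forall fun p => ?_)
    rw [norm_mul]
    exact mul_le_mul (hwM _) (hwM _) (norm_nonneg _) ((abs_nonneg _).trans (hwM p.1))
  have hP : Integrable (fun p : ℝ × ℝ =>
      (ψ p.1 ^ 2 * w p.1 - ψ p.2 ^ 2 * w p.2) * (w p.1 - w p.2) / |p.1 - p.2| ^ a) volume := by
    simp only [localized_energy_identity]
    exact hQ.sub hwR
  have hshear : MeasurePreserving (fun p : ℝ × ℝ => (p.1, p.1 + p.2)) volume volume :=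
    measurePreserving_prod_add (volume : Measure ℝ) (volume : Measure ℝ)
  have hemb : MeasurableEmbedding (fun p : ℝ × ℝ => (p.1, p.1 + p.2)) :=
    (MeasurableEquiv.shearAddRight ℝ).measurableEmbedding
  have hB := hshear.integrable_comp_of_integrable hP
  have hQs := hshear.integrable_comp_of_integrable hQ
  have hRs := hshear.integrable_comp_of_integrable hR
  have hsum : ∫ p : ℝ × ℝ,
      (ψ p.1 ^ 2 * w p.1 * (w (p.1 + p.2) + w (p.1 - p.2) - 2 * w p.1) / |p.2| ^ a
      + (ψ p.1 ^ 2 * w p.1 - ψ (p.1 + p.2) ^ 2 * w (p.1 + p.2)) * (w p.1 - w (p.1 + p.2))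
        / |p.1 - (p.1 + p.2)| ^ a) = 0 := by
    have hFB := hF.add hB
    rw [Measure.volume_eq_prod] at hFB hQs hRs ⊢
    rw [← integral_prod_swap]
    refine (integral_prod _ hFB.swap).trans (integral_eq_zero_of_ae ?_)
    filter_upwards [hFB.swap.prod_right_ae, hQs.swap.prod_right_ae, hRs.swap.prod_right_ae]
      with z h1 h2 h3
    simp only [Function.comp_def, Prod.swap_prod_mk, Pi.add_apply, sub_add_cancel_left, abs_neg,
      Pi.zero_apply] at h1 h2 h3 ⊢
    by_cases hk : |z| ^ a = 0
    · simp [hk]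
    let K : ℝ → ℝ := fun x => ψ (x + z) ^ 2 * w (x + z) * (w (x + z) - w x)
    have hKc : Continuous K := by fun_prop
    have heq : ∀ x, ψ x ^ 2 * w x * (w (x + z) + w (x - z) - 2 * w x) / |z| ^ a
        + (ψ x ^ 2 * w x - ψ (x + z) ^ 2 * w (x + z)) * (w x - w (x + z)) / |z| ^ a
        = (K x - K (x - z)) / |z| ^ a := by
      intro x
      simp only [K, sub_add_cancel]
      ring
    simp only [heq] at h1 ⊢
    have hd : Integrable (fun x => K x - K (x - z)) := by
      simpa [div_mul_cancel₀ _ hk] using h1.mul_const (|z| ^ a)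
    have hq : Integrable (fun x => (ψ x * w x - ψ (x + z) * w (x + z)) ^ 2) := by
      simpa [div_mul_cancel₀ _ hk] using h2.mul_const (|z| ^ a)
    have hr : Integrable (fun x => (ψ x - ψ (x + z)) ^ 2) := by
      simpa [div_mul_cancel₀ _ hk] using h3.mul_const (|z| ^ a)
    have hK2 : Integrable (fun x => K x ^ 2) := by
      refine ((hq.const_mul (2 * M ^ 2)).add (hr.const_mul (2 * M ^ 2 * M ^ 2))).mono'
        (by fun_prop) (Eventually.of_forall fun x => ?_)
      have hw1 : w x ^ 2 ≤ M ^ 2 := sq_le_sq' (abs_le.1 (hwM x)).1 (abs_le.1 (hwM x)).2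
      have hw2 : w (x + z) ^ 2 ≤ M ^ 2 :=
        sq_le_sq' (abs_le.1 (hwM _)).1 (abs_le.1 (hwM _)).2
      have hψ2 : ψ (x + z) ^ 2 ≤ 1 := (sq_le_one_iff_abs_le_one _).2 (hψ1 _)
      have hfac : ψ (x + z) ^ 2 * w (x + z) ^ 2 ≤ M ^ 2 :=
        (mul_le_mul hψ2 hw2 (sq_nonneg _) zero_le_one).trans_eq (one_mul _)
      have hD : (ψ (x + z) * (w (x + z) - w x)) ^ 2
          ≤ 2 * (ψ x * w x - ψ (x + z) * w (x + z)) ^ 2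
            + 2 * (M ^ 2 * (ψ x - ψ (x + z)) ^ 2) := by
        have h4 : w x ^ 2 * (ψ x - ψ (x + z)) ^ 2 ≤ M ^ 2 * (ψ x - ψ (x + z)) ^ 2 :=
          mul_le_mul_of_nonneg_right hw1 (sq_nonneg _)
        nlinarith [sq_nonneg ((ψ x * w x - ψ (x + z) * w (x + z)) + w x * (ψ x - ψ (x + z)))]
      rw [Real.norm_of_nonneg (sq_nonneg _)]
      calc K x ^ 2
          = ψ (x + z) ^ 2 * w (x + z) ^ 2 * (ψ (x + z) * (w (x + z) - w x)) ^ 2 := by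
            simp only [K]; ring
        _ ≤ M ^ 2 * _ := mul_le_mul hfac hD (sq_nonneg _) (sq_nonneg _)
        _ = _ := by simp only [Pi.add_apply]; ring
    rw [integral_div, integral_sub_comp_sub_eq_zero hKc hK2 z hd, zero_div]
  replace hsum := (integral_add hF hB).symm.trans hsum
  have hBP := hshear.integral_comp hemb (fun p : ℝ × ℝ =>
      (ψ p.1 ^ 2 * w p.1 - ψ p.2 ^ 2 * w p.2) * (w p.1 - w p.2) / |p.1 - p.2| ^ a)
  have hPQ : ∫ p : ℝ × ℝ,
      (ψ p.1 ^ 2 * w p.1 - ψ p.2 ^ 2 * w p.2) * (w p.1 - w p.2) / |p.1 - p.2| ^ a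
      = (∫ p : ℝ × ℝ, (ψ p.1 * w p.1 - ψ p.2 * w p.2) ^ 2 / |p.1 - p.2| ^ a)
        - ∫ p : ℝ × ℝ, w p.1 * w p.2 * ((ψ p.1 - ψ p.2) ^ 2 / |p.1 - p.2| ^ a) := by
    simp only [localized_energy_identity]
    exact integral_sub hQ hwR
  have hQ0 : 0 ≤ ∫ p : ℝ × ℝ, (ψ p.1 * w p.1 - ψ p.2 * w p.2) ^ 2 / |p.1 - p.2| ^ a :=
    integral_nonneg fun p => by positivity
  have hle : ∫ p : ℝ × ℝ, w p.1 * w p.2 * ((ψ p.1 - ψ p.2) ^ 2 / |p.1 - p.2| ^ a)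
      ≤ M ^ 2 * ∫ p : ℝ × ℝ, (ψ p.1 - ψ p.2) ^ 2 / |p.1 - p.2| ^ a := by
    rw [← integral_const_mul]
    refine integral_mono hwR (hR.const_mul _) fun p => ?_
    refine mul_le_mul_of_nonneg_right ?_ (by positivity)
    calc w p.1 * w p.2 ≤ |w p.1| * |w p.2| := by rw [← abs_mul]; exact le_abs_self _
      _ ≤ M * M := mul_le_mul (hwM _) (hwM _) (abs_nonneg _) ((abs_nonneg _).trans (hwM p.1))
      _ = M ^ 2 := (sq M).symm
  simp only [Function.comp_def] at hsum
  linarith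

/-- Scaling of the Gagliardo energy on the line. -/
theorem integral_gagliardo_comp_div (u : ℝ → ℝ) (a : ℝ) {R : ℝ} (hR : 0 < R) :
    ∫ p : ℝ × ℝ, (u (p.1 / R) - u (p.2 / R)) ^ 2 / |p.1 - p.2| ^ a
      = R ^ (2 - a) * ∫ p : ℝ × ℝ, (u p.1 - u p.2) ^ 2 / |p.1 - p.2| ^ a := by
  have h := Measure.integral_comp_inv_smul (volume : Measure (ℝ × ℝ))
    (fun p : ℝ × ℝ => (u p.1 - u p.2) ^ 2 / |p.1 - p.2| ^ a) R
  have hpt : ∀ p : ℝ × ℝ, (u (p.1 / R) - u (p.2 / R)) ^ 2 / |p.1 - p.2| ^ a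
      = R ^ (-a) * ((u (R⁻¹ • p).1 - u (R⁻¹ • p).2) ^ 2 / |(R⁻¹ • p).1 - (R⁻¹ • p).2| ^ a) := by
    intro p
    have h1 : |R⁻¹ * p.1 - R⁻¹ * p.2| ^ a = R ^ (-a) * |p.1 - p.2| ^ a := by
      rw [← mul_sub, abs_mul, abs_of_pos (inv_pos.2 hR),
        Real.mul_rpow (inv_pos.2 hR).le (abs_nonneg _), Real.inv_rpow hR.le, Real.rpow_neg hR.le]
    have h2 : R ^ (-a) ≠ 0 := (Real.rpow_pos_of_pos hR _).ne'
    simp only [Prod.smul_fst, Prod.smul_snd, smul_eq_mul]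
    rw [h1, div_eq_inv_mul p.1, div_eq_inv_mul p.2, ← mul_div_assoc, mul_div_mul_left _ _ h2]
  simp only [hpt]
  rw [integral_const_mul, h, smul_eq_mul, ← mul_assoc]
  congr 1
  have hfr : Module.finrank ℝ (ℝ × ℝ) = 2 := by simp
  rw [hfr, abs_of_pos (by positivity), sub_eq_neg_add, Real.rpow_add hR]
  simp

/-- Estimate on the parabolic part:
`ε ∫ φ_δ(|x|/ε^β)² w Δ^{α/2} w dx ≤ C δ^{−(α−1)}` with `C` independent of `ε` and `δ`. -/
theorem parabolic_part_estimate
    (α β cα : ℝ) (hα1 : 1 < α) (hα2 : α < 2) (hβ : β = 1 / (α - 1)) (hcα : 0 < cα)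
    (φ : ℝ → ℝ) (hφ : ContDiff ℝ (⊤ : ℕ∞) φ) (hφmono : Monotone φ)
    (hφrange : ∀ x : ℝ, φ x ∈ Set.Icc (0 : ℝ) 1)
    (hφ0 : ∀ x ≤ (0 : ℝ), φ x = 0) (hφ1 : ∀ x : ℝ, 1 ≤ x → φ x = 1)
    (M : ℝ) (hM : 0 < M) :
    ∃ C : ℝ, 0 < C ∧ ∀ ε : ℝ, 0 < ε → ∀ δ : ℝ, 0 < δ → ∀ w : ℝ → ℝ,
      ContDiff ℝ 2 w →
      (∀ x : ℝ, |w x| ≤ M) → (∃ M₂ : ℝ, ∀ x : ℝ, |iteratedDeriv 2 w x| ≤ M₂) →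
      Integrable (fun p : ℝ × ℝ =>
        (φ (|p.1| / ε ^ β / δ)) ^ 2 * w p.1 *
          (w (p.1 + p.2) + w (p.1 - p.2) - 2 * w p.1) / |p.2| ^ (1 + α)) volume →
      Integrable (fun p : ℝ × ℝ =>
        (φ (|p.1| / ε ^ β / δ) * w p.1 - φ (|p.2| / ε ^ β / δ) * w p.2) ^ 2
          / |p.1 - p.2| ^ (1 + α)) volume →
      Integrable (fun p : ℝ × ℝ =>
        (φ (|p.1| / ε ^ β / δ) - φ (|p.2| / ε ^ β / δ)) ^ 2
          / |p.1 - p.2| ^ (1 + α)) volume →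
      ε * (∫ x : ℝ, (φ (|x| / ε ^ β / δ)) ^ 2 * w x * fracLap cα α w x)
        ≤ C * δ ^ (-(α - 1)) := by
  set I := ∫ p : ℝ × ℝ, (φ |p.1| - φ |p.2|) ^ 2 / |p.1 - p.2| ^ (1 + α) with hI
  have hI0 : 0 ≤ I := integral_nonneg fun p => by positivity
  refine ⟨cα / 2 * (M ^ 2 * I) + 1, by positivity, ?_⟩
  intro ε hε δ hδ w hw hwM _ hF hQ hR
  have hεβ : 0 < ε ^ β := Real.rpow_pos_of_pos hε _
  have hφc := hφ.continuous
  have hcacc := integral_second_difference_le (ψ := fun x => φ (|x| / ε ^ β / δ)) (by fun_prop)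
    hw.continuous (fun x => abs_le.2 ⟨by linarith [(hφrange (|x| / ε ^ β / δ)).1],
      (hφrange _).2⟩) hwM hF hQ hR
  have hscale := integral_gagliardo_comp_div (fun x => φ |x|) (1 + α) (mul_pos hεβ hδ)
  have habs : ∀ x : ℝ, |x / (ε ^ β * δ)| = |x| / ε ^ β / δ := by
    intro x
    rw [abs_div, abs_of_pos (mul_pos hεβ hδ), div_div]
  simp only [habs] at hscale
  rw [hscale, ← hI] at hcacc
  have hfub : ∫ x : ℝ, (φ (|x| / ε ^ β / δ)) ^ 2 * w x * fracLap cα α w x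
      = cα / 2 * ∫ p : ℝ × ℝ, (φ (|p.1| / ε ^ β / δ)) ^ 2 * w p.1 *
          (w (p.1 + p.2) + w (p.1 - p.2) - 2 * w p.1) / |p.2| ^ (1 + α) := by
    rw [Measure.volume_eq_prod] at hF ⊢
    rw [integral_prod _ hF, ← integral_const_mul]
    congr 1 with x
    simp only [fracLap, mul_div_assoc]
    rw [integral_const_mul]
    ring
  have hpow : ε * (ε ^ β * δ) ^ (2 - (1 + α)) = δ ^ (-(α - 1)) := by
    have hexp : β * (2 - (1 + α)) = -1 := by
      have : α - 1 ≠ 0 := by linarith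
      rw [hβ]
      field_simp
      ring
    rw [Real.mul_rpow hεβ.le hδ.le, ← Real.rpow_mul hε.le, hexp, Real.rpow_neg_one, ← mul_assoc,
      mul_inv_cancel₀ hε.ne', one_mul]
    congr 1
    ring
  rw [hfub]
  calc _ ≤ ε * (cα / 2 * (M ^ 2 * ((ε ^ β * δ) ^ (2 - (1 + α)) * I))) := by gcongr
    _ = cα / 2 * (M ^ 2 * I) * δ ^ (-(α - 1)) := by rw [← hpow]; ring
    _ ≤ _ := mul_le_mul_of_nonneg_right (by linarith) (Real.rpow_nonneg hδ.le _)
end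

section
/- Let 1 < α < 2, let w : ℝ → ℝ be a bounded C² function with bounded second derivative, and let φ : ℝ → [0,1] be measurable. Assume that (x,z) ↦ φ(x)² w(x)(w(x+z) + w(x−z) − 2w(x))|z|^{−1−α} is absolutely integrable on ℝ², that ∬_{ℝ²} (φ(x) w(x) − φ(y) w(y))² |x−y|^{−1−α} dx dy < ∞, and that ∬_{ℝ²} (φ(x) − φ(y))² |x−y|^{−1−α} dx dy < ∞. Then ∫_ℝ φ(x)² w(x) Δ^{α/2}w(x) dx ≤ (c_α/2) ∬_{ℝ²} (φ(x) − φ(y))² w(x) w(y) |x−y|^{−1−α} dy dx. -/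
open MeasureTheory Real Filter
open scoped ENNReal NNReal

open Topology in
/-- The integral of a square-integrable function over a window of fixed length vanishes as the
window moves to infinity along any filter for which the square integrals converge. -/
theorem tendsto_intervalIntegral_window_zero {h : ℝ → ℝ} (hh : MemLp h 2) {z : ℝ} (hz : 0 ≤ z)
    {l : Filter ℝ} {L : ℝ}
    (h₁ : Tendsto (fun R => ∫ x in (0 : ℝ)..R, h x ^ 2) l (𝓝 L))
    (h₂ : Tendsto (fun R => ∫ x in (0 : ℝ)..(R + z), h x ^ 2) l (𝓝 L)) :
    Tendsto (fun R => ∫ x in R..(R + z), h x) l (𝓝 0) := by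
  have hsq : Integrable (fun x => h x ^ 2) := hh.integrable_sq
  have hloc : LocallyIntegrable h := hh.locallyIntegrable (by norm_num)
  have hint : ∀ a b, IntervalIntegrable h volume a b := fun a b =>
    (hloc.integrableOn_isCompact isCompact_uIcc).intervalIntegrable
  have hintsq : ∀ a b, IntervalIntegrable (fun x => h x ^ 2) volume a b :=
    fun a b => hsq.intervalIntegrable
  have hdiff : Tendsto (fun R => ∫ x in R..(R + z), h x ^ 2) l (𝓝 0) := by
    have := h₂.sub h₁
    rw [sub_self] at this
    refine this.congr fun R => ?_
    exact intervalIntegral.integral_interval_sub_left (hintsq _ _) (hintsq _ _)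
  have hbound : ∀ R, ‖∫ x in R..(R + z), h x‖ ≤ √(z * ∫ x in R..(R + z), h x ^ 2) := by
    intro R
    have key : ∀ t : ℝ, 0 ≤ z * (t * t) + (-2 * ∫ x in R..(R + z), h x) * t
        + ∫ x in R..(R + z), h x ^ 2 := by
      intro t
      have h0 : 0 ≤ ∫ x in R..(R + z), (h x - t) ^ 2 :=
        intervalIntegral.integral_nonneg (by linarith) fun x _ => sq_nonneg _
      have h1 : ∫ x in R..(R + z), (h x - t) ^ 2
          = ∫ x in R..(R + z), (h x ^ 2 - 2 * t * h x + t ^ 2) := by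
        congr 1; ext x; ring
      rw [h1, intervalIntegral.integral_add ((hintsq _ _).sub ((hint _ _).const_mul _))
        intervalIntegrable_const, intervalIntegral.integral_sub (hintsq _ _)
        ((hint _ _).const_mul _), intervalIntegral.integral_const_mul,
        intervalIntegral.integral_const, smul_eq_mul] at h0
      linarith
    have hd := discrim_le_zero key
    rw [discrim] at hd
    rw [Real.norm_eq_abs]
    apply Real.abs_le_sqrt
    nlinarith
  have hlim : Tendsto (fun R => √(z * ∫ x in R..(R + z), h x ^ 2)) l (𝓝 0) := by
    simpa using (hdiff.const_mul z).sqrt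
  exact squeeze_zero_norm hbound hlim

/-- If `h` is square integrable and the increment `h (x + z) - h x` is integrable, then the
increment has zero integral. -/
theorem integral_increment_eq_zero {h : ℝ → ℝ} (hh : MemLp h 2) (z : ℝ)
    (hi : Integrable fun x => h (x + z) - h x) : ∫ x, (h (x + z) - h x) = 0 := by
  have main : ∀ z : ℝ, 0 ≤ z → Integrable (fun x => h (x + z) - h x) →
      ∫ x, (h (x + z) - h x) = 0 := by
    intro z hz hi
    have hsq : Integrable (fun x => h x ^ 2) := hh.integrable_sq
    have hloc : LocallyIntegrable h := hh.locallyIntegrable (by norm_num)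
    have hint : ∀ a b, IntervalIntegrable h volume a b := fun a b =>
    (hloc.integrableOn_isCompact isCompact_uIcc).intervalIntegrable
    have hfull := intervalIntegral_tendsto_integral hi tendsto_neg_atTop_atBot tendsto_id
    have htop := intervalIntegral_tendsto_integral_Ioi 0 hsq.integrableOn tendsto_id
    have hbot := (intervalIntegral_tendsto_integral_Iic 0 hsq.integrableOn tendsto_id).neg
    simp only [← intervalIntegral.integral_symm, id] at hbot htop
    have w₁ := tendsto_intervalIntegral_window_zero hh hz htop
      (htop.comp (tendsto_atTop_add_const_right _ z tendsto_id))
    have w₂ := tendsto_intervalIntegral_window_zero hh hz hbot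
      (hbot.comp (tendsto_atBot_add_const_right _ z tendsto_id))
    have hlim := w₁.sub (w₂.comp tendsto_neg_atTop_atBot)
    rw [sub_zero] at hlim
    refine tendsto_nhds_unique hfull (hlim.congr fun R => ?_)
    have hshift : IntervalIntegrable (fun x => h (x + z)) volume (-R) R := by
      simpa using (hint (-R + z) (R + z)).comp_add_right z
    simp only [Function.comp, id]
    rw [intervalIntegral.integral_sub hshift (hint _ _),
      intervalIntegral.integral_comp_add_right]
    have e₁ := intervalIntegral.integral_add_adjacent_intervals (hint (-R) (-R + z))
      (hint (-R + z) (R + z))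
    have e₂ := intervalIntegral.integral_add_adjacent_intervals (hint (-R) R) (hint R (R + z))
    linarith
  rcases le_total 0 z with hz | hz
  · exact main z hz hi
  · have hi' : Integrable fun x => h (x + -z) - h x :=
      (hi.comp_add_right (-z)).neg.congr (ae_of_all _ fun x => by simp)
    have h0 := main (-z) (by linarith) hi'
    have e := integral_add_right_eq_self (μ := volume) (fun x => h (x + z) - h x) (-z)
    rw [← e, ← neg_eq_zero, ← integral_neg]
    simpa using h0

/-- Summation by parts at a fixed increment `z`: testing the second difference of `w` against
`φ² w` gives the weighted energy of `φ` minus the energy of `φ w`. -/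
theorem integral_secondDifference_eq_sub {φ w : ℝ → ℝ} {M z : ℝ}
    (hφ : Measurable φ) (hφrange : ∀ x, φ x ∈ Set.Icc (0 : ℝ) 1)
    (hw : Measurable w) (hM : ∀ x, |w x| ≤ M)
    (hker : Integrable fun x => φ x ^ 2 * w x * (w (x + z) + w (x - z) - 2 * w x))
    (hsym : Integrable fun x => (φ x * w x - φ (x + z) * w (x + z)) ^ 2)
    (hcut : Integrable fun x => (φ x - φ (x + z)) ^ 2)
    (hprod : Integrable fun x => (φ x - φ (x + z)) ^ 2 * w x * w (x + z)) :
    ∫ x, φ x ^ 2 * w x * (w (x + z) + w (x - z) - 2 * w x)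
      = (∫ x, (φ x - φ (x + z)) ^ 2 * w x * w (x + z))
        - ∫ x, (φ x * w x - φ (x + z) * w (x + z)) ^ 2 := by
  let h : ℝ → ℝ := fun x => φ (x + z) ^ 2 * w (x + z) * (w x - w (x + z))
  have hmeas : Measurable h := by fun_prop
  have hL2 : MemLp h 2 := by
    rw [memLp_two_iff_integrable_sq hmeas.aestronglyMeasurable]
    refine Integrable.mono' (((hsym.const_mul 2).add (hcut.const_mul (2 * M ^ 2))).const_mul (M ^ 2))
      (by fun_prop) (ae_of_all _ fun x => ?_)
    have hA : (φ (x + z) * w (x + z)) ^ 2 ≤ M ^ 2 := by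
      obtain ⟨h0, h1⟩ := hφrange (x + z)
      apply sq_le_sq'
      · nlinarith [abs_le.1 (hM (x + z))]
      · nlinarith [abs_le.1 (hM (x + z))]
    have hw2 : w x ^ 2 ≤ M ^ 2 := sq_le_sq' (abs_le.1 (hM x)).1 (abs_le.1 (hM x)).2
    have hfac : h x = (φ (x + z) * w (x + z)) * ((φ x * w x - φ (x + z) * w (x + z))
        - (φ x - φ (x + z)) * w x) := by simp only [h]; ring
    rw [Real.norm_of_nonneg (sq_nonneg _), hfac, mul_pow]
    refine mul_le_mul hA ?_ (sq_nonneg _) (sq_nonneg _)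
    simp only [Pi.add_apply]
    nlinarith [sq_nonneg ((φ x * w x - φ (x + z) * w (x + z)) + (φ x - φ (x + z)) * w x),
      mul_le_mul_of_nonneg_left hw2 (sq_nonneg (φ x - φ (x + z)))]
  have hincr : (fun x => h (x + -z) - h x) = fun x =>
      φ x ^ 2 * w x * (w (x + z) + w (x - z) - 2 * w x)
        - ((φ x - φ (x + z)) ^ 2 * w x * w (x + z)
          - (φ x * w x - φ (x + z) * w (x + z)) ^ 2) := by
    ext x
    simp only [h, ← sub_eq_add_neg, sub_add_cancel]
    ring
  have hdiff : Integrable fun x => (φ x - φ (x + z)) ^ 2 * w x * w (x + z)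
      - (φ x * w x - φ (x + z) * w (x + z)) ^ 2 := hprod.sub hsym
  have h0 := integral_increment_eq_zero hL2 (-z) (by rw [hincr]; exact hker.sub hdiff)
  rw [hincr, integral_sub hker hdiff, integral_sub hprod hsym] at h0
  linarith

/-- Fubini's theorem for a function integrable on the plane, in the coordinates given by a point
and an increment. -/
theorem integrable_increment_coordinates {f : ℝ × ℝ → ℝ} (hf : Integrable f) :
    (∀ᵐ z : ℝ, Integrable fun x => f (x, x + z)) ∧
    Integrable (fun z => ∫ x, f (x, x + z)) ∧
    ∫ p, f p = ∫ z, ∫ x, f (x, x + z) := by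
  have hmp : MeasurePreserving (fun p : ℝ × ℝ => (p.1, p.1 + p.2)) volume volume :=
    measurePreserving_prod_add volume volume
  have hi : Integrable (fun p : ℝ × ℝ => f (p.1, p.1 + p.2)) :=
    hmp.integrable_comp_of_integrable hf
  refine ⟨hi.prod_left_ae, hi.integral_prod_right, ?_⟩
  have he : ∫ p : ℝ × ℝ, f (p.1, p.1 + p.2) = ∫ p, f p :=
    hmp.integral_comp (MeasurableEquiv.shearAddRight ℝ).measurableEmbedding f
  rw [← he]
  exact integral_prod_symm _ hi

/-- Weighted coercivity of the fractional Laplacian: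
`∫ φ² w Δ^{α/2} w dx ≤ (c_α/2) ∬ (φ(x) − φ(y))² w(x) w(y) |x−y|^{−1−α} dy dx`. -/
theorem weighted_fracLap_coercivity
    (α cα : ℝ) (hα1 : 1 < α) (hα2 : α < 2) (hcα : 0 < cα)
    (w : ℝ → ℝ) (hwreg : ContDiff ℝ 2 w)
    (hwbdd : ∃ M : ℝ, ∀ x : ℝ, |w x| ≤ M ∧ |iteratedDeriv 2 w x| ≤ M)
    (φ : ℝ → ℝ) (hφmeas : Measurable φ) (hφrange : ∀ x : ℝ, φ x ∈ Set.Icc (0 : ℝ) 1)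
    (hker : Integrable (fun p : ℝ × ℝ =>
      (φ p.1) ^ 2 * w p.1 * (w (p.1 + p.2) + w (p.1 - p.2) - 2 * w p.1)
        / |p.2| ^ (1 + α)) volume)
    (hsym : Integrable (fun p : ℝ × ℝ =>
      (φ p.1 * w p.1 - φ p.2 * w p.2) ^ 2 / |p.1 - p.2| ^ (1 + α)) volume)
    (hcut : Integrable (fun p : ℝ × ℝ =>
      (φ p.1 - φ p.2) ^ 2 / |p.1 - p.2| ^ (1 + α)) volume) :
    (∫ x : ℝ, (φ x) ^ 2 * w x * fracLap cα α w x)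
      ≤ (cα / 2) * ∫ p : ℝ × ℝ,
          (φ p.1 - φ p.2) ^ 2 * w p.1 * w p.2 / |p.1 - p.2| ^ (1 + α) := by
  obtain ⟨M, hM'⟩ := hwbdd
  have hM : ∀ x, |w x| ≤ M := fun x => (hM' x).1
  have hw : Measurable w := hwreg.continuous.measurable
  have hprod : Integrable (fun p : ℝ × ℝ =>
      (φ p.1 - φ p.2) ^ 2 * w p.1 * w p.2 / |p.1 - p.2| ^ (1 + α)) volume := by
    refine Integrable.mono' (hcut.const_mul (M * M))
      (Measurable.aestronglyMeasurable (by fun_prop)) (ae_of_all _ fun p => ?_)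
    have hww : |w p.1 * w p.2| ≤ M * M := by
      rw [abs_mul]
      exact mul_le_mul (hM _) (hM _) (abs_nonneg _) ((abs_nonneg _).trans (hM p.1))
    have hk : 0 ≤ (φ p.1 - φ p.2) ^ 2 / |p.1 - p.2| ^ (1 + α) := by positivity
    calc ‖(φ p.1 - φ p.2) ^ 2 * w p.1 * w p.2 / |p.1 - p.2| ^ (1 + α)‖
        = |w p.1 * w p.2| * ((φ p.1 - φ p.2) ^ 2 / |p.1 - p.2| ^ (1 + α)) := by
          rw [← abs_of_nonneg hk, ← abs_mul, Real.norm_eq_abs]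
          congr 1; ring
      _ ≤ _ := mul_le_mul_of_nonneg_right hww hk
  obtain ⟨hsymz, hsymI, hsymE⟩ := integrable_increment_coordinates hsym
  obtain ⟨hcutz, -, -⟩ := integrable_increment_coordinates hcut
  obtain ⟨hprodz, hprodI, hprodE⟩ := integrable_increment_coordinates hprod
  have hkerz := hker.prod_left_ae
  have hlhs : ∫ x : ℝ, φ x ^ 2 * w x * fracLap cα α w x = (cα / 2) * ∫ p : ℝ × ℝ,
      φ p.1 ^ 2 * w p.1 * (w (p.1 + p.2) + w (p.1 - p.2) - 2 * w p.1) / |p.2| ^ (1 + α) := by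
    have hF := integral_prod _ hker
    rw [Measure.volume_eq_prod, hF, ← integral_const_mul]
    refine integral_congr_ae (ae_of_all _ fun x => ?_)
    simp only [fracLap]
    rw [mul_left_comm, ← integral_const_mul]
    simp only [mul_div_assoc]
  have hslice : ∀ᵐ z : ℝ,
      ∫ x, φ x ^ 2 * w x * (w (x + z) + w (x - z) - 2 * w x) / |z| ^ (1 + α)
        = (∫ x, (φ x - φ (x + z)) ^ 2 * w x * w (x + z) / |x - (x + z)| ^ (1 + α))
          - ∫ x, (φ x * w x - φ (x + z) * w (x + z)) ^ 2 / |x - (x + z)| ^ (1 + α) := by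
    filter_upwards [hsymz, hcutz, hprodz, hkerz, Measure.ae_ne volume 0] with z h1 h2 h3 h4 hz
    simp only [sub_add_cancel_left, abs_neg] at h1 h2 h3 ⊢
    have hK : |z| ^ (1 + α) ≠ 0 := (Real.rpow_pos_of_pos (abs_pos.2 hz) _).ne'
    have of_div : ∀ {f : ℝ → ℝ}, Integrable (fun x => f x / |z| ^ (1 + α)) → Integrable f :=
      fun hf => by simpa [div_mul_cancel₀ _ hK] using hf.mul_const (|z| ^ (1 + α))
    simp only [integral_div]
    rw [integral_secondDifference_eq_sub hφmeas hφrange hw hM (of_div h4) (of_div h1) (of_div h2)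
      (of_div h3), sub_div]
  have hker_eq : ∫ p : ℝ × ℝ,
      φ p.1 ^ 2 * w p.1 * (w (p.1 + p.2) + w (p.1 - p.2) - 2 * w p.1) / |p.2| ^ (1 + α)
      = (∫ p : ℝ × ℝ, (φ p.1 - φ p.2) ^ 2 * w p.1 * w p.2 / |p.1 - p.2| ^ (1 + α))
        - ∫ p : ℝ × ℝ, (φ p.1 * w p.1 - φ p.2 * w p.2) ^ 2 / |p.1 - p.2| ^ (1 + α) := by
    have hF := integral_prod_symm _ hker
    rw [hprodE, hsymE, ← integral_sub hprodI hsymI, Measure.volume_eq_prod, hF]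
    exact integral_congr_ae hslice
  have hnonneg : 0 ≤ ∫ p : ℝ × ℝ,
      (φ p.1 * w p.1 - φ p.2 * w p.2) ^ 2 / |p.1 - p.2| ^ (1 + α) :=
    integral_nonneg fun p => by positivity
  rw [hlhs, hker_eq]
  exact mul_le_mul_of_nonneg_left (by linarith) (by positivity)
end
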